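/- arXiv:1912.10904 — 6 statements merged into one kernel-verified Lean document; each statement's English description precedes it below -/
import Mathlib

section
/- Let n ∈ ℕ and let f₀, …, fₙ : ℂ → ℂ be entire functions. Set ψ̂(z) = Σ_{ν=0}^{n} conj(z)^ν f_ν(z), and assume that ψ̂ satisfies the eigenvalue equation (z̄ − ∂_z)(∂_{z̄} ψ̂) = n·ψ̂ pointwise on ℂ (i.e. ψ̂·e^{−|z|²/2} belongs to the n-th Landau level). Then for every ν ∈ {0, …, n}, f_ν = (−1)^{n−ν} · C(n,ν) · fₙ^{(n−ν)}, where fₙ^{(k)} denotes the k-th complex derivative of fₙ. In particular, the state is completely determined by the holomorphic function fₙ and the Landau index n. -/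
noncomputable section

/-- Wirtinger derivative `∂_z F = ½(∂_x F − i ∂_y F)`. -/
def dz (F : ℂ → ℂ) (z : ℂ) : ℂ :=
  (1 / 2 : ℂ) * (fderiv ℝ F z 1 - Complex.I * fderiv ℝ F z Complex.I)

/-- Wirtinger derivative `∂_{z̄} F = ½(∂_x F + i ∂_y F)`. -/
def dzbar (F : ℂ → ℂ) (z : ℂ) : ℂ :=
  (1 / 2 : ℂ) * (fderiv ℝ F z 1 + Complex.I * fderiv ℝ F z Complex.I)

/-- The operator `z̄ − ∂_z`, sending `F` to `z ↦ conj z · F z − (∂_z F) z`. -/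
def Tbar (F : ℂ → ℂ) : ℂ → ℂ := fun z => (starRingEnd ℂ) z * F z - dz F z

open ComplexConjugate in
/-- The real derivative of `w ↦ Σ conj(w)^ν f_ν(w)` for entire `f_ν`. -/
theorem fderiv_sum_conj_pow_mul (N : ℕ) (f : ℕ → ℂ → ℂ)
    (hf : ∀ ν < N, Differentiable ℂ (f ν)) (z v : ℂ) :
    fderiv ℝ (fun w => ∑ ν ∈ Finset.range N, conj w ^ ν * f ν w) z v
      = ∑ ν ∈ Finset.range N,
          ((ν : ℂ) * conj z ^ (ν - 1) * conj v * f ν z + conj z ^ ν * (v * deriv (f ν) z)) := by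
  have hterm : ∀ ν ∈ Finset.range N, HasFDerivAt (fun w => conj w ^ ν * f ν w)
      (conj z ^ ν • (fderiv ℂ (f ν) z).restrictScalars ℝ
        + f ν z • ((ν • conj z ^ (ν - 1)) • (Complex.conjCLE : ℂ →L[ℝ] ℂ))) z := by
    intro ν hν
    have h1 : HasFDerivAt (fun w : ℂ => conj w) (Complex.conjCLE : ℂ →L[ℝ] ℂ) z :=
      Complex.conjCLE.hasFDerivAt
    exact (h1.pow ν).mul
      ((hf ν (Finset.mem_range.1 hν) z).hasFDerivAt.restrictScalars ℝ)
  rw [(HasFDerivAt.fun_sum hterm).fderiv, sum_apply]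
  refine Finset.sum_congr rfl fun ν _ => ?_
  have hv : fderiv ℂ (f ν) z v = v * deriv (f ν) z := by
    rw [fderiv_eq_smul_deriv, smul_eq_mul]
  simp [hv]
  ring

open ComplexConjugate in
theorem dz_sum_conj_pow_mul (N : ℕ) (f : ℕ → ℂ → ℂ)
    (hf : ∀ ν < N, Differentiable ℂ (f ν)) (z : ℂ) :
    dz (fun w => ∑ ν ∈ Finset.range N, conj w ^ ν * f ν w) z
      = ∑ ν ∈ Finset.range N, conj z ^ ν * deriv (f ν) z := by
  rw [dz, fderiv_sum_conj_pow_mul N f hf, fderiv_sum_conj_pow_mul N f hf, Finset.mul_sum,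
    ← Finset.sum_sub_distrib, Finset.mul_sum]
  refine Finset.sum_congr rfl fun ν _ => ?_
  simp only [map_one, Complex.conj_I]
  linear_combination (1 / 2 * ((ν : ℂ) * conj z ^ (ν - 1) * f ν z - conj z ^ ν * deriv (f ν) z))
    * Complex.I_mul_I

open ComplexConjugate in
theorem dzbar_sum_conj_pow_mul (N : ℕ) (f : ℕ → ℂ → ℂ)
    (hf : ∀ ν < N + 1, Differentiable ℂ (f ν)) (z : ℂ) :
    dzbar (fun w => ∑ ν ∈ Finset.range (N + 1), conj w ^ ν * f ν w) z
      = ∑ ν ∈ Finset.range N, conj z ^ ν * (((ν : ℂ) + 1) * f (ν + 1) z) := by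
  have key : dzbar (fun w => ∑ ν ∈ Finset.range (N + 1), conj w ^ ν * f ν w) z
      = ∑ ν ∈ Finset.range (N + 1), (ν : ℂ) * conj z ^ (ν - 1) * f ν z := by
    rw [dzbar, fderiv_sum_conj_pow_mul _ f hf, fderiv_sum_conj_pow_mul _ f hf, Finset.mul_sum,
      ← Finset.sum_add_distrib, Finset.mul_sum]
    refine Finset.sum_congr rfl fun ν _ => ?_
    simp only [map_one, Complex.conj_I]
    linear_combination
      (1 / 2 * (conj z ^ ν * deriv (f ν) z - (ν : ℂ) * conj z ^ (ν - 1) * f ν z))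
        * Complex.I_mul_I
  rw [key, Finset.sum_range_succ']
  simp only [Nat.cast_zero, zero_mul, add_zero, Nat.add_sub_cancel, Nat.cast_add, Nat.cast_one]
  exact Finset.sum_congr rfl fun ν _ => by ring

open ComplexConjugate in
/-- Uniqueness of the entire coefficients of a polyanalytic function. -/
theorem eq_zero_of_sum_conj_pow_mul_eq_zero (N : ℕ) (g : ℕ → ℂ → ℂ)
    (hg : ∀ ν < N, Differentiable ℂ (g ν))
    (h : ∀ z, ∑ ν ∈ Finset.range N, conj z ^ ν * g ν z = 0) :
    ∀ ν < N, ∀ z, g ν z = 0 := by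
  induction N generalizing g with
  | zero => intro ν hν; omega
  | succ N ih =>
    have hsucc : ∀ ν < N, ∀ z, g (ν + 1) z = 0 := by
      intro ν hν z
      have hz := ih (fun ν z => ((ν : ℂ) + 1) * g (ν + 1) z)
        (fun ν hν => (hg (ν + 1) (by omega)).const_mul _)
        (fun z => by
          rw [← dzbar_sum_conj_pow_mul N g hg z, funext h]
          simp [dzbar]) ν hν z
      exact (mul_eq_zero.1 hz).resolve_left (Nat.cast_add_one_ne_zero ν)
    intro ν hν z
    cases ν with
    | zero =>
      have hz := h z
      rw [Finset.sum_range_succ', Finset.sum_eq_zero] at hz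
      · simpa using hz
      · intro ν hν
        rw [hsucc ν (Finset.mem_range.1 hν), mul_zero]
    | succ ν => exact hsucc ν (by omega) z

/-- if `ψ̂(z) = Σ_{ν=0}^n conj(z)^ν f_ν(z)` with `f_ν` entire satisfies the
eigenvalue equation `(z̄ − ∂_z)(∂_{z̄} ψ̂) = n ψ̂` pointwise, then
`f_ν = (−1)^{n−ν} C(n,ν) fₙ^{(n−ν)}` for every `ν ≤ n`. -/
theorem stmt1 (n : ℕ) (f : ℕ → ℂ → ℂ) (hf : ∀ ν ≤ n, Differentiable ℂ (f ν))
    (ψ : ℂ → ℂ)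
    (hψ : ψ = fun w => ∑ ν ∈ Finset.range (n + 1), (starRingEnd ℂ) w ^ ν * f ν w)
    (heig : ∀ z : ℂ, Tbar (dzbar ψ) z = (n : ℂ) * ψ z) :
    ∀ ν ≤ n, f ν
      = fun z => (-1 : ℂ) ^ (n - ν) * (n.choose ν : ℂ) * iteratedDeriv (n - ν) (f n) z := by
  subst hψ
  have hf' : ∀ ν < n + 1, Differentiable ℂ (f ν) := fun ν hν => hf ν (by omega)
  have hrec : ∀ ν < n, ∀ z,
      ((n : ℂ) - ν) * f ν z + ((ν : ℂ) + 1) * deriv (f (ν + 1)) z = 0 := by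
    refine eq_zero_of_sum_conj_pow_mul_eq_zero n
      (fun ν z => ((n : ℂ) - ν) * f ν z + ((ν : ℂ) + 1) * deriv (f (ν + 1)) z) ?_ ?_
    · intro ν hν
      exact ((hf' ν (by omega)).const_mul _).add ((hf' (ν + 1) (by omega)).deriv.const_mul _)
    · intro z
      have h := heig z
      rw [Tbar, funext (dzbar_sum_conj_pow_mul n f hf'),
        dz_sum_conj_pow_mul n (fun ν z => ((ν : ℂ) + 1) * f (ν + 1) z)
          (fun ν hν => (hf' (ν + 1) (by omega)).const_mul _)] at h
      simp only [deriv_const_mul_field] at h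
      have hshift : (starRingEnd ℂ) z * ∑ ν ∈ Finset.range n,
            (starRingEnd ℂ) z ^ ν * (((ν : ℂ) + 1) * f (ν + 1) z)
          = ∑ ν ∈ Finset.range (n + 1), (starRingEnd ℂ) z ^ ν * ((ν : ℂ) * f ν z) := by
        rw [Finset.sum_range_succ', Finset.mul_sum]
        simp only [Nat.cast_zero, zero_mul, mul_zero, add_zero, Nat.cast_add, Nat.cast_one]
        exact Finset.sum_congr rfl fun ν _ => by ring
      rw [hshift, Finset.sum_range_succ, Finset.sum_range_succ] at h
      have hsplit : ∑ ν ∈ Finset.range n, (starRingEnd ℂ) z ^ ν *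
            (((n : ℂ) - ν) * f ν z + ((ν : ℂ) + 1) * deriv (f (ν + 1)) z)
          = n * ∑ ν ∈ Finset.range n, (starRingEnd ℂ) z ^ ν * f ν z
            - ∑ ν ∈ Finset.range n, (starRingEnd ℂ) z ^ ν * ((ν : ℂ) * f ν z)
            + ∑ ν ∈ Finset.range n,
                (starRingEnd ℂ) z ^ ν * (((ν : ℂ) + 1) * deriv (f (ν + 1)) z) := by
        rw [Finset.mul_sum, ← Finset.sum_sub_distrib, ← Finset.sum_add_distrib]
        exact Finset.sum_congr rfl fun ν _ => by ring
      rw [hsplit]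
      linear_combination -h
  intro ν hν
  induction hν using Nat.decreasingInduction with
  | self => simp
  | of_succ ν hν ih =>
    funext z
    have h := hrec ν hν z
    obtain ⟨k, rfl⟩ := Nat.exists_eq_add_of_lt hν
    have hd : ν + k + 1 - ν = k + 1 := by omega
    have hd' : ν + k + 1 - (ν + 1) = k := by omega
    rw [hd'] at ih
    rw [ih, deriv_const_mul_field, ← iteratedDeriv_succ] at h
    rw [hd]
    have hchoose : (((ν + k + 1).choose (ν + 1) : ℕ) : ℂ) * (ν + 1)
        = ((ν + k + 1).choose ν : ℂ) * (k + 1) := by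
      have := Nat.choose_succ_right_eq (ν + k + 1) ν
      rw [hd] at this
      exact_mod_cast this
    have hk : (k : ℂ) + 1 ≠ 0 := Nat.cast_add_one_ne_zero k
    apply mul_left_cancel₀ hk
    push_cast at h
    linear_combination h
      - (-1) ^ k * iteratedDeriv (k + 1) (f (ν + k + 1)) z * hchoose
end
end

section
/- Let n ∈ ℕ and let g₀, …, gₙ : ℂ → ℂ be polynomials. Set φ(z) = (Σ_{ν=0}^{n} conj(z)^ν g_ν(z))·e^{−|z|²/2} and P(z) = (Σ_{ν=0}^{n} g_ν^{(ν)}(z))·e^{−|z|²/2}, where g_ν^{(ν)} is the ν-th complex derivative of g_ν. Then φ − P is orthogonal in L²(ℂ) to every lowest-Landau-level basis function: for every m ∈ ℕ, ∫_ℂ conj(z^m e^{−|z|²/2}) · (φ(z) − P(z)) d²z = 0. Hence P is the orthogonal projection of φ onto the lowest Landau level. -/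
open MeasureTheory

noncomputable section

/-- The norm of a Gaussian monomial on the complex plane. -/
lemma norm_gaussian_monomial (a b : ℕ) (z : ℂ) :
    ‖z ^ a * (starRingEnd ℂ) z ^ b * Complex.exp (-(Complex.normSq z : ℂ))‖
      = ‖z‖ ^ ((a + b : ℕ) : ℝ) * Real.exp (-‖z‖ ^ (2 : ℝ)) := by
  rw [norm_mul, norm_mul, norm_pow, norm_pow, RCLike.norm_conj, ← pow_add, Real.rpow_natCast,
    Real.rpow_two, ← Complex.ofReal_neg, Complex.norm_exp_ofReal, Complex.normSq_eq_norm_sq]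

lemma integral_norm_pow_mul_exp_neg_sq (k : ℕ) :
    ∫ z : ℂ, ‖z‖ ^ (k : ℝ) * Real.exp (-‖z‖ ^ (2 : ℝ))
      = Real.pi * Real.Gamma ((k + 2) / 2) := by
  rw [Complex.integral_rpow_mul_exp_neg_rpow (by norm_num)
    (by linarith [k.cast_nonneg (α := ℝ)])]
  ring

lemma integrable_gaussian_monomial (a b : ℕ) :
    Integrable fun z : ℂ =>
      z ^ a * (starRingEnd ℂ) z ^ b * Complex.exp (-(Complex.normSq z : ℂ)) := by
  have hc : Continuous fun z : ℂ =>
      z ^ a * (starRingEnd ℂ) z ^ b * Complex.exp (-(Complex.normSq z : ℂ)) := by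
    have := Complex.continuous_normSq
    have := Complex.continuous_conj
    fun_prop
  rw [← integrable_norm_iff hc.aestronglyMeasurable]
  simp only [norm_gaussian_monomial]
  apply Integrable.of_integral_ne_zero
  rw [integral_norm_pow_mul_exp_neg_sq]
  exact (mul_pos Real.pi_pos (Real.Gamma_pos_of_pos (by positivity))).ne'

/-- The moments of the Gaussian measure on the complex plane. -/
lemma integral_gaussian_monomial (a b : ℕ) :
    ∫ z : ℂ, z ^ a * (starRingEnd ℂ) z ^ b * Complex.exp (-(Complex.normSq z : ℂ))
      = if a = b then (Real.pi : ℂ) * (a.factorial : ℂ) else 0 := by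
  split_ifs with h
  · subst h
    have hf : ∀ z : ℂ, z ^ a * (starRingEnd ℂ) z ^ a * Complex.exp (-(Complex.normSq z : ℂ))
        = ((‖z‖ ^ ((a + a : ℕ) : ℝ) * Real.exp (-‖z‖ ^ (2 : ℝ)) : ℝ) : ℂ) := by
      intro z
      rw [← mul_pow, Complex.mul_conj, Real.rpow_natCast, Real.rpow_two,
        Complex.normSq_eq_norm_sq, ← two_mul, pow_mul]
      push_cast
      rfl
    simp only [hf]
    rw [integral_complex_ofReal, integral_norm_pow_mul_exp_neg_sq]
    have : (((a + a : ℕ) : ℝ) + 2) / 2 = a + 1 := by push_cast; ring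
    rw [this, Real.Gamma_nat_eq_factorial]
    push_cast
    rfl
  · set F : ℂ → ℂ := fun z =>
      z ^ a * (starRingEnd ℂ) z ^ b * Complex.exp (-(Complex.normSq z : ℂ)) with hF
    have hab : ((a : ℂ) - b) ≠ 0 := sub_ne_zero.mpr (by exact_mod_cast h)
    set c : Circle := Circle.exp (Real.pi / (a - b)) with hc
    have hcc : (c : ℂ) ^ a * (starRingEnd ℂ) (c : ℂ) ^ b = -1 := by
      rw [← Circle.coe_inv_eq_conj, hc, ← Circle.exp_neg, Circle.coe_exp, Circle.coe_exp,
        ← Complex.exp_nat_mul, ← Complex.exp_nat_mul, ← Complex.exp_add, ← Complex.exp_pi_mul_I]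
      congr 1
      push_cast
      field_simp
      ring
    have hrot : ∀ z, F (rotation c z) = -F z := by
      intro z
      simp only [hF, rotation_apply, map_mul, mul_pow, Circle.normSq_coe, one_mul]
      linear_combination (z ^ a * (starRingEnd ℂ) z ^ b *
        Complex.exp (-(Complex.normSq z : ℂ))) * hcc
    have hint : ∫ z, F (rotation c z) = ∫ z, F z :=
      (rotation c).measurePreserving.integral_comp
        (rotation c).toHomeomorph.measurableEmbedding F
    simp only [hrot, integral_neg] at hint
    exact self_eq_neg.mp hint.symm

/-- Integrability of a polynomial in `z` times a power of the conjugate of `z` against the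
Gaussian weight. -/
lemma integrable_gaussian_polynomial (b : ℕ) (p : Polynomial ℂ) :
    Integrable fun z : ℂ =>
      p.eval z * (starRingEnd ℂ) z ^ b * Complex.exp (-(Complex.normSq z : ℂ)) := by
  induction p using Polynomial.induction_on' with
  | add p q hp hq =>
    simp only [Polynomial.eval_add, add_mul]
    exact hp.add hq
  | monomial k c =>
    simpa only [Polynomial.eval_monomial, mul_assoc] using
      (integrable_gaussian_monomial k b).const_mul c

/-- Against the Gaussian weight, multiplication by the conjugate of `z` acts on polynomials as
differentiation. -/
lemma integral_gaussian_conj_pow_add (m ν : ℕ) (p : Polynomial ℂ) :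
    ∫ z : ℂ, p.eval z * (starRingEnd ℂ) z ^ (m + ν) * Complex.exp (-(Complex.normSq z : ℂ))
      = ∫ z : ℂ, (Polynomial.derivative^[ν] p).eval z * (starRingEnd ℂ) z ^ m *
          Complex.exp (-(Complex.normSq z : ℂ)) := by
  induction p using Polynomial.induction_on' with
  | add p q hp hq =>
    simp only [iterate_map_add, Polynomial.eval_add, add_mul]
    rw [integral_add (integrable_gaussian_polynomial _ _) (integrable_gaussian_polynomial _ _),
      integral_add (integrable_gaussian_polynomial _ _) (integrable_gaussian_polynomial _ _),
      hp, hq]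
  | monomial k c =>
    have hd : ∀ z, (Polynomial.derivative^[ν] (Polynomial.monomial k c)).eval z
        = c * (k.descFactorial ν * z ^ (k - ν)) := by
      intro z
      rw [← Polynomial.C_mul_X_pow_eq_monomial, Polynomial.iterate_derivative_C_mul,
        Polynomial.iterate_derivative_X_pow_eq_natCast_mul]
      simp
    simp only [hd, Polynomial.eval_monomial, mul_assoc, integral_const_mul]
    simp only [← mul_assoc, integral_gaussian_monomial]
    rcases lt_or_ge k ν with h | h
    · rw [Nat.descFactorial_of_lt h, if_neg (by omega)]
      simp
    · obtain ⟨j, rfl⟩ := Nat.exists_eq_add_of_le' h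
      have hj := Nat.factorial_mul_descFactorial h
      rw [Nat.add_sub_cancel] at hj ⊢
      simp only [Nat.add_right_cancel_iff]
      split_ifs
      · rw [← hj]
        push_cast
        ring
      · simp

/-- for polynomials `g₀, …, gₙ`, with
`φ(z) = (Σ_{ν≤n} conj(z)^ν g_ν(z)) e^{−|z|²/2}` and
`P(z) = (Σ_{ν≤n} g_ν^{(ν)}(z)) e^{−|z|²/2}`, the difference `φ − P` is orthogonal in `L²(ℂ)`
to every lowest-Landau-level basis function `z^m e^{−|z|²/2}`; hence `P` is the orthogonal
projection of `φ` onto the lowest Landau level. -/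
theorem stmt2 (n : ℕ) (g : ℕ → Polynomial ℂ)
    (φ P : ℂ → ℂ)
    (hφ : φ = fun z => (∑ ν ∈ Finset.range (n + 1), (starRingEnd ℂ) z ^ ν * (g ν).eval z)
      * Complex.exp (-(Complex.normSq z : ℂ) / 2))
    (hP : P = fun z => (∑ ν ∈ Finset.range (n + 1), (Polynomial.derivative^[ν] (g ν)).eval z)
      * Complex.exp (-(Complex.normSq z : ℂ) / 2)) :
    ∀ m : ℕ,
      ∫ z : ℂ, (starRingEnd ℂ) (z ^ m * Complex.exp (-(Complex.normSq z : ℂ) / 2))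
        * (φ z - P z) = 0 := by
  intro m
  subst hφ hP
  have hpt : ∀ z : ℂ, (starRingEnd ℂ) (z ^ m * Complex.exp (-(Complex.normSq z : ℂ) / 2))
      * ((∑ ν ∈ Finset.range (n + 1), (starRingEnd ℂ) z ^ ν * (g ν).eval z)
          * Complex.exp (-(Complex.normSq z : ℂ) / 2)
        - (∑ ν ∈ Finset.range (n + 1), (Polynomial.derivative^[ν] (g ν)).eval z)
          * Complex.exp (-(Complex.normSq z : ℂ) / 2))
      = ∑ ν ∈ Finset.range (n + 1),
        ((g ν).eval z * (starRingEnd ℂ) z ^ (m + ν) * Complex.exp (-(Complex.normSq z : ℂ))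
          - (Polynomial.derivative^[ν] (g ν)).eval z * (starRingEnd ℂ) z ^ m *
            Complex.exp (-(Complex.normSq z : ℂ))) := by
    intro z
    have hexp : Complex.exp (-(Complex.normSq z : ℂ))
        = Complex.exp (-(Complex.normSq z : ℂ) / 2) * Complex.exp (-(Complex.normSq z : ℂ) / 2) := by
      rw [← Complex.exp_add, add_halves]
    rw [map_mul, map_pow, ← Complex.exp_conj, map_div₀, map_neg, Complex.conj_ofReal,
      Complex.conj_ofNat, ← sub_mul, ← Finset.sum_sub_distrib, Finset.sum_mul, Finset.mul_sum]
    refine Finset.sum_congr rfl fun ν _ => ?_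
    rw [hexp]
    ring
  simp only [hpt]
  refine (integral_finsetSum _ fun ν _ =>
    (integrable_gaussian_polynomial _ _).sub (integrable_gaussian_polynomial _ _)).trans ?_
  refine Finset.sum_eq_zero fun ν _ => ?_
  rw [integral_sub' (integrable_gaussian_polynomial _ _) (integrable_gaussian_polynomial _ _),
    integral_gaussian_conj_pow_add, sub_self]
end
end

section
/- Let n ∈ ℕ and let f : ℂ → ℂ be entire. Then pointwise on ℂ: (1/n!) · conj(((z̄ − ∂_z)^n f)(z)) · ((z̄ − ∂_z)^n f)(z) · e^{−|z|²} = Σ_{l=0}^{n} C(n,l) · (1/l!) · (∂_{z̄}∂_z)^l [ w ↦ conj(f(w)) f(w) e^{−|w|²} ](z), i.e. |(z̄ − ∂_z)^n f|² e^{−|z|²}/n! = Lₙ(−∂_{z̄}∂_z)[|f|² e^{−|z|²}], where Lₙ is the Laguerre polynomial and ∂_{z̄}∂_z = ¼Δ with Δ the Laplacian on ℝ². -/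
noncomputable section

/-- The operator `∂_{z̄}∂_z = ¼Δ`. -/
def Dop (F : ℂ → ℂ) : ℂ → ℂ := dzbar (dz F)

open scoped ContDiff ComplexConjugate

/-- The Laguerre polynomial `Lₙ(-X)`. -/
def laguerreNeg (n : ℕ) : Polynomial ℂ :=
  ∑ l ∈ Finset.range (n + 1), Polynomial.monomial l ((n.choose l : ℂ) * (l.factorial : ℂ)⁻¹)

theorem laguerreNeg_coeff (n l : ℕ) :
    (laguerreNeg n).coeff l = (n.choose l : ℂ) * (l.factorial : ℂ)⁻¹ := by
  simp only [laguerreNeg, Polynomial.finsetSum_coeff, Polynomial.coeff_monomial,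
    Finset.sum_ite_eq', Finset.mem_range]
  split_ifs with h
  · rfl
  · rw [Nat.choose_eq_zero_of_lt (by lia)]
    simp

theorem laguerreNeg_recurrence (n : ℕ) :
    ((n : ℂ) + 2) • laguerreNeg (n + 2) = Polynomial.X * laguerreNeg (n + 1)
      + (2 * (n : ℂ) + 3) • laguerreNeg (n + 1) - ((n : ℂ) + 1) • laguerreNeg n := by
  ext l
  cases l with
  | zero =>
    simp [laguerreNeg_coeff]
    ring
  | succ l =>
    simp only [Polynomial.coeff_sub, Polynomial.coeff_add, Polynomial.coeff_smul,
      Polynomial.coeff_X_mul, laguerreNeg_coeff, smul_eq_mul, Nat.factorial_succ]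
    have h1 : ((n + 2).choose (l + 1) : ℂ) = (n + 1).choose l + (n + 1).choose (l + 1) := by
      exact_mod_cast Nat.choose_succ_succ (n + 1) l
    have h2 : ((n + 1).choose (l + 1) : ℂ) = n.choose l + n.choose (l + 1) := by
      exact_mod_cast Nat.choose_succ_succ n l
    have h3 : ((n : ℂ) + 1) * n.choose l = (n + 1).choose (l + 1) * (l + 1) := by
      exact_mod_cast Nat.add_one_mul_choose_eq n l
    have h4 : ((n : ℂ) + 2) * (n + 1).choose l = (n + 2).choose (l + 1) * (l + 1) := by
      exact_mod_cast Nat.add_one_mul_choose_eq (n + 1) l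
    have h5 : (l.factorial : ℂ) ≠ 0 := by exact_mod_cast l.factorial_ne_zero
    have h6 : (l : ℂ) + 1 ≠ 0 := by exact_mod_cast l.succ_ne_zero
    push_cast
    field_simp
    rw [h1] at h4 ⊢
    linear_combination h4 - ((n : ℂ) + 1) * h2 - h3

/-- The functions `ℂ → ℂ` which are smooth over `ℝ`. -/
def smoothFunctions : Submodule ℂ (ℂ → ℂ) where
  carrier := {F | ContDiff ℝ ∞ F}
  add_mem' {F G} (hF : ContDiff ℝ ∞ F) (hG : ContDiff ℝ ∞ G) := hF.add hG
  zero_mem' := (contDiff_const : ContDiff ℝ ∞ fun _ : ℂ => (0 : ℂ))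
  smul_mem' c F (hF : ContDiff ℝ ∞ F) := hF.const_smul c

section Wirtinger

variable {F G : ℂ → ℂ} {z : ℂ}

theorem dz_add (hF : DifferentiableAt ℝ F z) (hG : DifferentiableAt ℝ G z) :
    dz (F + G) z = dz F z + dz G z := by
  simp only [dz, fderiv_add hF hG, add_apply]
  ring

theorem dzbar_add (hF : DifferentiableAt ℝ F z) (hG : DifferentiableAt ℝ G z) :
    dzbar (F + G) z = dzbar F z + dzbar G z := by
  simp only [dzbar, fderiv_add hF hG, add_apply]
  ring

theorem dz_mul (hF : DifferentiableAt ℝ F z) (hG : DifferentiableAt ℝ G z) :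
    dz (F * G) z = dz F z * G z + F z * dz G z := by
  simp only [dz, fderiv_mul hF hG, add_apply, smul_apply, smul_eq_mul]
  ring

theorem dzbar_mul (hF : DifferentiableAt ℝ F z) (hG : DifferentiableAt ℝ G z) :
    dzbar (F * G) z = dzbar F z * G z + F z * dzbar G z := by
  simp only [dzbar, fderiv_mul hF hG, add_apply, smul_apply, smul_eq_mul]
  ring

theorem dz_smul (c : ℂ) (hF : DifferentiableAt ℝ F z) : dz (c • F) z = c * dz F z := by
  simp only [dz, fderiv_const_smul hF, smul_apply, smul_eq_mul]
  ring

theorem dzbar_smul (c : ℂ) (hF : DifferentiableAt ℝ F z) :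
    dzbar (c • F) z = c * dzbar F z := by
  simp only [dzbar, fderiv_const_smul hF, smul_apply, smul_eq_mul]
  ring

theorem HasFDerivAt.conj_comp {F' : ℂ →L[ℝ] ℂ} (hF : HasFDerivAt F F' z) :
    HasFDerivAt (fun w => conj (F w)) ((Complex.conjCLE : ℂ →L[ℝ] ℂ).comp F') z :=
  (Complex.conjCLE : ℂ →L[ℝ] ℂ).hasFDerivAt.comp z hF

theorem dz_conj (hF : DifferentiableAt ℝ F z) :
    dz (fun w => conj (F w)) z = conj (dzbar F z) := by
  simp [dz, dzbar, hF.hasFDerivAt.conj_comp.fderiv, sub_eq_add_neg, map_ofNat]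

theorem dzbar_conj (hF : DifferentiableAt ℝ F z) :
    dzbar (fun w => conj (F w)) z = conj (dz F z) := by
  simp [dz, dzbar, hF.hasFDerivAt.conj_comp.fderiv, sub_eq_add_neg, map_ofNat]

theorem dzbar_eq_zero (hF : DifferentiableAt ℂ F z) : dzbar F z = 0 := by
  have h := (hF.fderiv_restrictScalars ℝ)
  have h' : fderiv ℂ F z Complex.I = Complex.I * fderiv ℂ F z 1 := by
    simp
  simp only [dzbar, h, ContinuousLinearMap.coe_restrictScalars', h', ← mul_assoc,
    Complex.I_mul_I]
  ring

theorem dzbar_conj_self : dzbar (fun w => conj w) z = 1 := by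
  have h := dzbar_conj (F := id) (z := z) differentiableAt_id
  simpa [dz, one_add_one_eq_two, map_ofNat] using h

theorem ContDiff.conj_comp (hF : ContDiff ℝ ∞ F) : ContDiff ℝ ∞ (fun w => conj (F w)) :=
  (Complex.conjCLE : ℂ →L[ℝ] ℂ).contDiff.comp hF

theorem contDiff_fderiv_apply (hF : ContDiff ℝ ∞ F) (v : ℂ) :
    ContDiff ℝ ∞ (fun w => fderiv ℝ F w v) :=
  (hF.fderiv_right (m := ∞) le_rfl).clm_apply contDiff_const

theorem contDiff_dz (hF : ContDiff ℝ ∞ F) : ContDiff ℝ ∞ (dz F) :=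
  contDiff_const.mul ((contDiff_fderiv_apply hF 1).sub
    (contDiff_const.mul (contDiff_fderiv_apply hF Complex.I)))

theorem contDiff_dzbar (hF : ContDiff ℝ ∞ F) : ContDiff ℝ ∞ (dzbar F) :=
  contDiff_const.mul ((contDiff_fderiv_apply hF 1).add
    (contDiff_const.mul (contDiff_fderiv_apply hF Complex.I)))

theorem ContDiff.differentiableAt_real (hF : ContDiff ℝ ∞ F) : DifferentiableAt ℝ F z :=
  hF.differentiable (by simp) z

theorem differentiableAt_mul (hF : ContDiff ℝ ∞ F) (hG : ContDiff ℝ ∞ G) :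
    DifferentiableAt ℝ (F * G) z :=
  hF.differentiableAt_real.mul hG.differentiableAt_real

theorem differentiableAt_smul (c : ℂ) (hF : ContDiff ℝ ∞ F) : DifferentiableAt ℝ (c • F) z :=
  hF.differentiableAt_real.const_smul c

theorem fderiv_dz (hF : ContDiff ℝ ∞ F) (v : ℂ) : fderiv ℝ (dz F) z v =
    (1 / 2 : ℂ) * (fderiv ℝ (fderiv ℝ F) z v 1
      - Complex.I * fderiv ℝ (fderiv ℝ F) z v Complex.I) := by
  have h := (hF.fderiv_right (m := ∞) le_rfl).differentiable (by simp) z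
  have h' (u : ℂ) := h.hasFDerivAt.clm_apply (hasFDerivAt_const u z)
  have h'' := ((h' 1).sub ((h' Complex.I).const_mul Complex.I)).const_mul (1 / 2 : ℂ)
  refine (congrArg (fun L : ℂ →L[ℝ] ℂ => L v) h''.fderiv).trans ?_
  simp

theorem fderiv_dzbar (hF : ContDiff ℝ ∞ F) (v : ℂ) : fderiv ℝ (dzbar F) z v =
    (1 / 2 : ℂ) * (fderiv ℝ (fderiv ℝ F) z v 1
      + Complex.I * fderiv ℝ (fderiv ℝ F) z v Complex.I) := by
  have h := (hF.fderiv_right (m := ∞) le_rfl).differentiable (by simp) z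
  have h' (u : ℂ) := h.hasFDerivAt.clm_apply (hasFDerivAt_const u z)
  have h'' := ((h' 1).add ((h' Complex.I).const_mul Complex.I)).const_mul (1 / 2 : ℂ)
  refine (congrArg (fun L : ℂ →L[ℝ] ℂ => L v) h''.fderiv).trans ?_
  simp [mul_add]

theorem dzbar_dz_comm (hF : ContDiff ℝ ∞ F) : dzbar (dz F) z = dz (dzbar F) z := by
  have h : fderiv ℝ (fderiv ℝ F) z 1 Complex.I = fderiv ℝ (fderiv ℝ F) z Complex.I 1 :=
    ((contDiff_infty.1 hF 2).contDiffAt.isSymmSndFDerivAt (by simp)) 1 Complex.I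
  rw [dzbar, fderiv_dz hF, fderiv_dz hF, dz, fderiv_dzbar hF, fderiv_dzbar hF, h]
  ring

theorem contDiff_Dop (hF : ContDiff ℝ ∞ F) : ContDiff ℝ ∞ (Dop F) :=
  contDiff_dzbar (contDiff_dz hF)

theorem contDiff_Tbar (hF : ContDiff ℝ ∞ F) : ContDiff ℝ ∞ (Tbar F) :=
  (contDiff_id.conj_comp.mul hF).sub (contDiff_dz hF)

theorem contDiff_Tbar_iterate (hF : ContDiff ℝ ∞ F) (n : ℕ) : ContDiff ℝ ∞ (Tbar^[n] F) := by
  induction n with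
  | zero => exact hF
  | succ n ih =>
    rw [Function.iterate_succ_apply']
    exact contDiff_Tbar ih

/-- The commutation relation `[∂_{z̄}, z̄ − ∂_z] = 1`. -/
theorem dzbar_Tbar (hF : ContDiff ℝ ∞ F) : dzbar (Tbar F) z = F z + Tbar (dzbar F) z := by
  have hc : ContDiff ℝ ∞ (fun w : ℂ => conj w) := contDiff_id.conj_comp
  have h : Tbar F = (fun w => conj w) * F + (-1 : ℂ) • dz F := by
    ext w
    simp [Tbar, sub_eq_add_neg]
  rw [h, dzbar_add (differentiableAt_mul hc hF)
      (differentiableAt_smul (-1) (contDiff_dz hF)),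
    dzbar_mul hc.differentiableAt_real hF.differentiableAt_real,
    dzbar_smul _ (contDiff_dz hF).differentiableAt_real, dzbar_conj_self, dzbar_dz_comm hF, Tbar]
  ring

theorem Tbar_smul (c : ℂ) (hF : ContDiff ℝ ∞ F) : Tbar (c • F) = c • Tbar F := by
  ext w
  simp only [Tbar, dz_smul c hF.differentiableAt_real, Pi.smul_apply, smul_eq_mul]
  ring

/-- The Gaussian weight `e^{−|z|²}`. -/
def gaussianWeight (z : ℂ) : ℂ := Complex.exp (-(Complex.normSq z : ℂ))

theorem contDiff_gaussianWeight : ContDiff ℝ ∞ gaussianWeight := by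
  have h : gaussianWeight = fun z => Complex.exp (-(conj z * z)) := by
    ext z
    rw [gaussianWeight, Complex.normSq_eq_conj_mul_self]
  rw [h]
  exact (contDiff_id.conj_comp.mul contDiff_id).neg.cexp

theorem fderiv_gaussianWeight (v : ℂ) :
    fderiv ℝ gaussianWeight z v = -(conj v * z + conj z * v) * gaussianWeight z := by
  have h : gaussianWeight = fun z => Complex.exp (-(conj z * z)) := by
    ext z
    rw [gaussianWeight, Complex.normSq_eq_conj_mul_self]
  have h' := ((hasFDerivAt_id (𝕜 := ℝ) z).conj_comp.mul (hasFDerivAt_id (𝕜 := ℝ) z)).neg.cexp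
  rw [h]
  refine (congrArg (fun L : ℂ →L[ℝ] ℂ => L v) h'.fderiv).trans ?_
  simp
  ring

theorem dz_gaussianWeight : dz gaussianWeight z = -conj z * gaussianWeight z := by
  simp only [dz, fderiv_gaussianWeight, map_one, Complex.conj_I]
  linear_combination (-(1 / 2) * (z - conj z) * gaussianWeight z) * Complex.I_mul_I

theorem dzbar_gaussianWeight : dzbar gaussianWeight z = -z * gaussianWeight z := by
  simp only [dzbar, fderiv_gaussianWeight, map_one, Complex.conj_I]
  linear_combination ((1 / 2) * (z - conj z) * gaussianWeight z) * Complex.I_mul_I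

end Wirtinger

section Holomorphic

variable {f : ℂ → ℂ}

theorem Differentiable.contDiff_real (hf : Differentiable ℂ f) : ContDiff ℝ ∞ f :=
  hf.contDiff.restrict_scalars ℝ

theorem dzbar_Tbar_iterate (hf : Differentiable ℂ f) (n : ℕ) :
    dzbar (Tbar^[n] f) = (n : ℂ) • Tbar^[n - 1] f := by
  induction n with
  | zero =>
    ext z
    simp [dzbar_eq_zero (hf z)]
  | succ n ih =>
    ext z
    rw [Function.iterate_succ_apply', dzbar_Tbar (contDiff_Tbar_iterate hf.contDiff_real n), ih,
      Tbar_smul _ (contDiff_Tbar_iterate hf.contDiff_real _), ← Function.iterate_succ_apply' Tbar]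
    cases n with
    | zero => simp
    | succ n =>
      simp
      ring

/-- The weighted products `conj((z̄ − ∂_z)^p f) (z̄ − ∂_z)^q f e^{−|z|²}`. -/
def weightedProduct (f : ℂ → ℂ) (p q : ℕ) : ℂ → ℂ :=
  (fun w => conj (Tbar^[p] f w)) * Tbar^[q] f * gaussianWeight

theorem contDiff_weightedProduct (hf : Differentiable ℂ f) (p q : ℕ) :
    ContDiff ℝ ∞ (weightedProduct f p q) :=
  ((contDiff_Tbar_iterate hf.contDiff_real p).conj_comp.mul
    (contDiff_Tbar_iterate hf.contDiff_real q)).mul contDiff_gaussianWeight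

theorem dz_weightedProduct (hf : Differentiable ℂ f) (p q : ℕ) :
    dz (weightedProduct f p q) =
      (p : ℂ) • weightedProduct f (p - 1) q + (-1 : ℂ) • weightedProduct f p (q + 1) := by
  ext z
  have hT := contDiff_Tbar_iterate hf.contDiff_real
  rw [weightedProduct, dz_mul (differentiableAt_mul (hT p).conj_comp (hT q))
      contDiff_gaussianWeight.differentiableAt_real,
    dz_mul (hT p).conj_comp.differentiableAt_real (hT q).differentiableAt_real,
    dz_conj (hT p).differentiableAt_real, dzbar_Tbar_iterate hf, dz_gaussianWeight]
  simp only [weightedProduct, Function.iterate_succ_apply', Tbar, Pi.add_apply, Pi.smul_apply,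
    Pi.mul_apply, smul_eq_mul, map_mul, map_natCast]
  ring

theorem dzbar_weightedProduct (hf : Differentiable ℂ f) (p q : ℕ) :
    dzbar (weightedProduct f p q) =
      (q : ℂ) • weightedProduct f p (q - 1) + (-1 : ℂ) • weightedProduct f (p + 1) q := by
  ext z
  have hT := contDiff_Tbar_iterate hf.contDiff_real
  rw [weightedProduct, dzbar_mul (differentiableAt_mul (hT p).conj_comp (hT q))
      contDiff_gaussianWeight.differentiableAt_real,
    dzbar_mul (hT p).conj_comp.differentiableAt_real (hT q).differentiableAt_real,
    dzbar_conj (hT p).differentiableAt_real, dzbar_Tbar_iterate hf, dzbar_gaussianWeight]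
  simp only [weightedProduct, Function.iterate_succ_apply', Tbar, Pi.add_apply, Pi.smul_apply,
    Pi.mul_apply, smul_eq_mul, map_mul, map_sub, Complex.conj_conj]
  ring

theorem Dop_weightedProduct (hf : Differentiable ℂ f) (n : ℕ) :
    Dop (weightedProduct f n n) = (n : ℂ) ^ 2 • weightedProduct f (n - 1) (n - 1)
      + weightedProduct f (n + 1) (n + 1) - (2 * (n : ℂ) + 1) • weightedProduct f n n := by
  ext z
  have hA (p q : ℕ) := contDiff_weightedProduct hf p q
  rw [Dop, dz_weightedProduct hf,
    dzbar_add (differentiableAt_smul _ (hA _ _))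
      (differentiableAt_smul _ (hA _ _)),
    dzbar_smul _ (hA _ _).differentiableAt_real, dzbar_smul _ (hA _ _).differentiableAt_real,
    dzbar_weightedProduct hf, dzbar_weightedProduct hf]
  cases n with
  | zero => simp; ring
  | succ n =>
    simp
    ring

end Holomorphic

/-- `∂_{z̄}∂_z` as an endomorphism of the space of smooth functions. -/
def DopLinear : smoothFunctions →ₗ[ℂ] smoothFunctions where
  toFun F := ⟨Dop F, contDiff_Dop F.2⟩
  map_add' F G := by
    have hF : ContDiff ℝ ∞ (F : ℂ → ℂ) := F.2
    have hG : ContDiff ℝ ∞ (G : ℂ → ℂ) := G.2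
    ext z
    have h : dz (F + G : ℂ → ℂ) = dz F + dz G :=
      funext fun w => dz_add hF.differentiableAt_real hG.differentiableAt_real
    simp only [Dop, Submodule.coe_add, h, dzbar_add (contDiff_dz hF).differentiableAt_real
      (contDiff_dz hG).differentiableAt_real, Pi.add_apply]
  map_smul' c F := by
    have hF : ContDiff ℝ ∞ (F : ℂ → ℂ) := F.2
    ext z
    have h : dz (c • F : ℂ → ℂ) = c • dz F :=
      funext fun w => dz_smul c hF.differentiableAt_real
    simp only [Dop, Submodule.coe_smul, h, dzbar_smul c (contDiff_dz hF).differentiableAt_real,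
      Pi.smul_apply, smul_eq_mul, RingHom.id_apply]

theorem coe_DopLinear_pow (l : ℕ) (F : smoothFunctions) :
    ((DopLinear ^ l) F : ℂ → ℂ) = Dop^[l] F := by
  induction l with
  | zero => rfl
  | succ l ih =>
    rw [pow_succ', Module.End.mul_apply, Function.iterate_succ_apply', ← ih]
    rfl

/-- A sequence satisfying the Laguerre recurrence for an endomorphism `D` is `Lₙ(-D)` applied to
its initial term. -/
theorem eq_aeval_laguerreNeg {V : Type*} [AddCommGroup V] [Module ℂ V] (D : V →ₗ[ℂ] V)
    (B : ℕ → V) (hB : ∀ n : ℕ, ((n : ℂ) + 1) • B (n + 1)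
      = D (B n) + (2 * (n : ℂ) + 1) • B n - (n : ℂ) • B (n - 1)) (n : ℕ) :
    B n = Polynomial.aeval D (laguerreNeg n) (B 0) := by
  induction n using Nat.twoStepInduction with
  | zero => simp [laguerreNeg]
  | one =>
    have h := hB 0
    simp only [Nat.cast_zero, zero_add, one_smul, mul_zero, zero_smul, sub_zero] at h
    simp [laguerreNeg, Finset.sum_range_succ, h, Polynomial.aeval_monomial, add_comm]
  | more n ih₀ ih₁ =>
    have hn : (n : ℂ) + 2 ≠ 0 := by exact_mod_cast (n + 1).succ_ne_zero
    apply smul_right_injective V hn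
    have h := hB (n + 1)
    have h' := congrArg (fun P => Polynomial.aeval D P (B 0)) (laguerreNeg_recurrence n)
    simp only [map_sub, map_add, map_smul, map_mul, Polynomial.aeval_X, LinearMap.sub_apply,
      LinearMap.add_apply, LinearMap.smul_apply, Module.End.mul_apply, ← ih₀, ← ih₁] at h'
    simp only [h']
    push_cast at h
    rw [show (n : ℂ) + 1 + 1 = n + 2 by ring] at h
    rw [h, show 2 * ((n : ℂ) + 1) + 1 = 2 * n + 3 by ring]

/-- reshuffling differentiations: for entire `f`, pointwise on `ℂ`,
`(1/n!)·|((z̄−∂_z)^n f)(z)|² e^{−|z|²} = Σ_{l=0}^n C(n,l)(1/l!)(∂_{z̄}∂_z)^l [|f|² e^{−|·|²}](z)`,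
i.e. `|(z̄−∂_z)^n f|² e^{−|z|²}/n! = Lₙ(−∂_{z̄}∂_z)[|f|² e^{−|z|²}]`. -/
theorem stmt3 (n : ℕ) (f : ℂ → ℂ) (hf : Differentiable ℂ f) (z : ℂ) :
    (n.factorial : ℂ)⁻¹ * (starRingEnd ℂ) ((Tbar^[n] f) z) * (Tbar^[n] f) z
        * Complex.exp (-(Complex.normSq z : ℂ))
      = ∑ l ∈ Finset.range (n + 1), (n.choose l : ℂ) * (l.factorial : ℂ)⁻¹ *
          (Dop^[l] (fun w => (starRingEnd ℂ) (f w) * f w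
            * Complex.exp (-(Complex.normSq w : ℂ)))) z := by
  have hA (p q : ℕ) := contDiff_weightedProduct hf p q
  let B : ℕ → smoothFunctions := fun k =>
    (k.factorial : ℂ)⁻¹ • ⟨weightedProduct f k k, hA k k⟩
  have hB (k : ℕ) : ((k : ℂ) + 1) • B (k + 1)
      = DopLinear (B k) + (2 * (k : ℂ) + 1) • B k - (k : ℂ) • B (k - 1) := by
    have hk' : (k : ℂ) + 1 ≠ 0 := by exact_mod_cast k.succ_ne_zero
    have hD : (DopLinear ⟨weightedProduct f k k, hA k k⟩ : ℂ → ℂ) = _ :=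
      Dop_weightedProduct hf k
    ext w
    simp only [B, map_smul, Submodule.coe_sub, Submodule.coe_add, Submodule.coe_smul, hD,
      Pi.sub_apply, Pi.add_apply, Pi.smul_apply, smul_eq_mul]
    cases k with
    | zero => simp
    | succ k =>
      have hk₀ : (k.factorial : ℂ) ≠ 0 := by exact_mod_cast k.factorial_ne_zero
      have hk₁ : (k : ℂ) + 1 ≠ 0 := by exact_mod_cast k.succ_ne_zero
      push_cast [Nat.factorial_succ, Nat.add_sub_cancel] at hk' ⊢
      field_simp
      ring
  have h := congrArg (fun F : smoothFunctions => (F : ℂ → ℂ) z)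
    (eq_aeval_laguerreNeg DopLinear B hB n)
  have hB₀ : (B 0 : ℂ → ℂ) = fun w => conj (f w) * f w
      * Complex.exp (-(Complex.normSq w : ℂ)) := by
    ext w
    simp [B, weightedProduct, gaussianWeight]
  simp only [laguerreNeg, map_sum, Polynomial.aeval_monomial, LinearMap.sum_apply,
    Module.End.mul_apply, Module.algebraMap_end_apply, Submodule.coe_sum, Submodule.coe_smul,
    coe_DopLinear_pow, hB₀, Finset.sum_apply, Pi.smul_apply, smul_eq_mul] at h
  rw [← h]
  simp only [B, weightedProduct, gaussianWeight, Submodule.coe_smul, Pi.smul_apply, Pi.mul_apply,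
    smul_eq_mul]
  ring
end
end

section
/- Bargmann reproducing property (the kernel G with n = 0 is a reproducing kernel): for every polynomial f : ℂ → ℂ and every Z ∈ ℂ, (1/π) ∫_ℂ e^{Z·conj(z)} e^{−|z|²} f(z) d²z = f(Z). -/
open MeasureTheory

noncomputable section

theorem exp_mul_mul_exp_neg_sq_le (c r : ℝ) :
    Real.exp (c * r) * Real.exp (-r ^ 2) ≤
      Real.exp (c ^ 2 / 2) * Real.exp (-(1 / 2) * r ^ 2) := by
  rw [← Real.exp_add, ← Real.exp_add, Real.exp_le_exp]
  nlinarith [sq_nonneg (c - r)]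

theorem Complex.integrable_exp_neg_mul_norm_sq {b : ℝ} (hb : 0 < b) :
    Integrable fun w : ℂ => Real.exp (-b * ‖w‖ ^ 2) := by
  have h := (GaussianFourier.integrable_cexp_neg_mul_sq_norm_add (V := ℂ) (b := (b : ℂ))
    (by simpa using hb) 0 0).norm
  refine h.congr (.of_forall fun w => ?_)
  simp [Complex.norm_exp, ← Complex.ofReal_pow]

theorem Polynomial.exists_norm_eval_le_mul_exp_norm (f : Polynomial ℂ) :
    ∃ C, 0 ≤ C ∧ ∀ z, ‖f.eval z‖ ≤ C * Real.exp ‖z‖ := by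
  refine ⟨∑ i ∈ Finset.range (f.natDegree + 1), ‖f.coeff i‖ * i.factorial, by positivity,
    fun z => ?_⟩
  rw [Polynomial.eval_eq_sum_range, Finset.sum_mul]
  refine (norm_sum_le _ _).trans (Finset.sum_le_sum fun i _ => ?_)
  rw [norm_mul, norm_pow, mul_assoc]
  gcongr
  have := Real.pow_div_factorial_le_exp _ (norm_nonneg z) i
  rwa [div_le_iff₀' (by positivity)] at this

/-- The mean value property of entire functions of exponential type for the Gaussian measure. -/
theorem Differentiable.integral_mul_exp_neg_normSq {F : ℂ → ℂ} (hF : Differentiable ℂ F)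
    {C c : ℝ} (hC : 0 ≤ C) (hbound : ∀ w, ‖F w‖ ≤ C * Real.exp (c * ‖w‖)) :
    ∫ w : ℂ, F w * Complex.exp (-(Complex.normSq w : ℂ)) = Real.pi * F 0 := by
  set g : ℂ → ℂ := fun w => Complex.exp (-(Complex.normSq w : ℂ)) with hg
  have hg_cont : Continuous g := by
    have := Complex.continuous_normSq
    fun_prop
  have hg_norm (w : ℂ) : ‖g w‖ = Real.exp (-‖w‖ ^ 2) := by
    simp [hg, Complex.norm_exp, Complex.normSq_eq_norm_sq, -Complex.ofReal_pow]
  have hg_int : ∫ w, g w = Real.pi := by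
    have := GaussianFourier.integral_cexp_neg_mul_sq_norm (V := ℂ) (b := 1) (by simp)
    simpa [hg, Complex.normSq_eq_norm_sq] using this
  have hrot (θ : ℝ) : ∫ w, F (w * circleMap 0 1 θ) * g w = ∫ w, F w * g w := by
    rw [← (rotation (Circle.exp θ)).measurePreserving.integral_comp'
      (f := (rotation (Circle.exp θ)).toMeasurableEquiv) (fun w => F w * g w)]
    refine integral_congr_ae (.of_forall fun w => ?_)
    simp [hg, circleMap, mul_comm, Complex.normSq_eq_norm_sq]
  have hmean (w : ℂ) : ∫ θ in (0 : ℝ)..2 * Real.pi, F (w * circleMap 0 1 θ)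
      = 2 * Real.pi * F 0 := by
    have hd : Differentiable ℂ fun ζ => F (w * ζ) := by fun_prop
    have h := hd.diffContOnCl.circleAverage (c := 0) (R := 1)
    rw [Real.circleAverage_def, inv_smul_eq_iff₀ (by positivity)] at h
    simpa using h
  have : IsFiniteMeasure (volume.restrict (Set.uIoc 0 (2 * Real.pi))) :=
    ⟨by simp [Set.uIoc]⟩
  have hint : Integrable (Function.uncurry fun (θ : ℝ) (w : ℂ) => F (w * circleMap 0 1 θ) * g w)
      ((volume.restrict (Set.uIoc 0 (2 * Real.pi))).prod volume) := by
    refine Integrable.mono' (g := fun p : ℝ × ℂ => C * Real.exp (c ^ 2 / 2) *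
      Real.exp (-(1 / 2) * ‖p.2‖ ^ 2)) ?_ ?_ (.of_forall fun p => ?_)
    · exact ((Complex.integrable_exp_neg_mul_norm_sq (by norm_num)).comp_snd _).const_mul _
    · refine Continuous.aestronglyMeasurable ?_
      have := hF.continuous
      have := continuous_circleMap 0 1
      simp only [Function.uncurry_def]
      fun_prop
    · have h := hbound (p.2 * circleMap 0 1 p.1)
      simp only [norm_mul, norm_circleMap_zero, abs_one, mul_one] at h
      simp only [Function.uncurry_def, norm_mul, hg_norm]
      calc _ ≤ C * Real.exp (c * ‖p.2‖) * Real.exp (-‖p.2‖ ^ 2) := by gcongr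
        _ ≤ _ := by
          rw [mul_assoc, mul_assoc]
          exact mul_le_mul_of_nonneg_left (exp_mul_mul_exp_neg_sq_le _ _) hC
  have hswap := intervalIntegral_integral_swap hint
  simp_rw [hrot, intervalIntegral.integral_mul_const, hmean, integral_const_mul, hg_int] at hswap
  have hpi : (2 * Real.pi : ℂ) ≠ 0 := by simp [Real.pi_ne_zero]
  apply mul_left_cancel₀ hpi
  simp at hswap
  linear_combination hswap

/-- Bargmann reproducing property: for every polynomial `f : ℂ → ℂ`
and every `Z ∈ ℂ`, `(1/π) ∫_ℂ e^{Z z̄} e^{−|z|²} f(z) d²z = f(Z)`. -/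
theorem stmt11 (f : Polynomial ℂ) (Z : ℂ) :
    (Real.pi : ℂ)⁻¹ * ∫ z : ℂ, Complex.exp (Z * (starRingEnd ℂ) z)
        * Complex.exp (-(Complex.normSq z : ℂ)) * f.eval z = f.eval Z := by
  obtain ⟨C, hC, hf⟩ := f.exists_norm_eval_le_mul_exp_norm
  have hF : Differentiable ℂ fun w =>
      Complex.exp (-(w * (starRingEnd ℂ) Z)) * f.eval (w + Z) := by
    have := f.differentiable
    fun_prop
  have key := hF.integral_mul_exp_neg_normSq (C := C * Real.exp ‖Z‖) (c := ‖Z‖ + 1)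
    (by positivity) fun w => by
      rw [norm_mul]
      calc _ ≤ Real.exp (‖w‖ * ‖Z‖) * (C * Real.exp (‖w‖ + ‖Z‖)) := by
            gcongr
            · refine (Complex.norm_exp_le_exp_norm _).trans_eq ?_
              simp
            · refine (hf _).trans ?_
              gcongr
              exact norm_add_le _ _
        _ = _ := by
            rw [mul_left_comm, mul_assoc, ← Real.exp_add, ← Real.exp_add]
            ring_nf
  rw [← integral_add_right_eq_self _ Z, inv_mul_eq_iff_eq_mul₀ (by simp [Real.pi_ne_zero])]
  simp only [zero_mul, neg_zero, Complex.exp_zero, one_mul, zero_add] at key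
  rw [← key]
  refine integral_congr_ae (.of_forall fun w => ?_)
  simp only
  rw [mul_right_comm (Complex.exp (-(w * _))), ← Complex.exp_add, ← Complex.exp_add]
  simp only [Complex.normSq_eq_conj_mul_self, map_add]
  ring_nf
end
end

section
/- Plane waves projected in Landau levels: let φ_{n,m}(z) = (π n! m!)^{−1/2} ((z̄ − ∂_z)^n (w ↦ w^m))(z) e^{−|z|²/2}. For q ∈ ℂ identify the plane wave e^{i q·r} with the function z ↦ e^{i Re(conj(q)·z)}. Then for all n, m, m′ ∈ ℕ and all q ∈ ℂ, ∫_ℂ conj(φ_{n,m′}(z)) e^{i Re(conj(q)·z)} φ_{n,m}(z) d²z = Lₙ(|q|²/4) · ∫_ℂ conj(φ_{0,m′}(z)) e^{i Re(conj(q)·z)} φ_{0,m}(z) d²z, where Lₙ(u) = Σ_{l=0}^{n} C(n,l)(−u)^l/l! is the Laguerre polynomial. -/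
open MeasureTheory

noncomputable section

/-- The Landau-level basis function `φ_{n,m}` (units `B = 2`). -/
def phi (n m : ℕ) (z : ℂ) : ℂ :=
  (Real.sqrt (Real.pi * n.factorial * m.factorial) : ℂ)⁻¹
    * (Tbar^[n] (fun w => w ^ m)) z * Complex.exp (-(Complex.normSq z : ℂ) / 2)

/-- The Laguerre polynomial `Lₙ(u) = Σ_{l=0}^n C(n,l)(−u)^l/l!`. -/
def Lag (n : ℕ) (u : ℝ) : ℝ :=
  ∑ l ∈ Finset.range (n + 1), (n.choose l : ℝ) * (-u) ^ l / l.factorial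

open Polynomial in
/-- A two-index sequence with the contraction rules of the oscillator algebra is determined by
its value at the origin. -/
theorem contraction_sum (I : ℕ → ℕ → ℂ) (α β : ℂ)
    (hα : ∀ a, I (a + 1) 0 = α * I a 0)
    (hβ : ∀ a b, I a (b + 1) = β * I a b + a * I (a - 1) b) (a b : ℕ) :
    I a b = I 0 0 * ∑ k ∈ Finset.range (b + 1),
      (b.choose k : ℂ) * β ^ (b - k) * a.descFactorial k * α ^ (a - k) := by
  let D : Module.End ℂ ℂ[X] := derivative
  let C' : Module.End ℂ ℂ[X] := algebraMap ℂ (Module.End ℂ ℂ[X]) β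
  have key : ∀ b a, I a b = I 0 0 * (((D + C') ^ b) (X ^ a : ℂ[X])).eval α := by
    intro b
    induction b with
    | zero =>
      intro a
      induction a with
      | zero => simp
      | succ a ih => rw [hα, ih]; simp; ring
    | succ b ih =>
      intro a
      have h : (D + C') (X ^ a : ℂ[X]) = (a : ℂ) • X ^ (a - 1) + β • X ^ a := by
        simp [D, C', derivative_X_pow, Polynomial.smul_eq_C_mul, Algebra.algebraMap_eq_smul_one]
      rw [hβ, ih, ih, pow_succ, Module.End.mul_apply, h]
      simp only [map_add, map_smul, eval_add, eval_smul, smul_eq_mul]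
      ring
  have hc : Commute D C' := (Algebra.commutes β D).symm
  rw [key, hc.add_pow, LinearMap.sum_apply, eval_finsetSum]
  congr 1
  refine Finset.sum_congr rfl fun k _ => ?_
  have h1 : (D ^ k * C' ^ (b - k) * (b.choose k : Module.End ℂ ℂ[X])) (X ^ a : ℂ[X])
      = ((b.choose k : ℂ) * β ^ (b - k)) • (derivative^[k] (X ^ a : ℂ[X])) := by
    have h2 : C' ^ (b - k) = algebraMap ℂ (Module.End ℂ ℂ[X]) (β ^ (b - k)) := by
      simp [C']
    have h3 : (b.choose k : Module.End ℂ ℂ[X])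
        = algebraMap ℂ (Module.End ℂ ℂ[X]) (b.choose k : ℂ) := by simp
    rw [h2, h3, mul_assoc, ← map_mul, Module.End.mul_apply, Module.algebraMap_end_apply,
      map_smul, Module.End.pow_apply, mul_comm]
  rw [h1, iterate_derivative_X_pow_eq_smul]
  simp only [eval_smul, eval_pow, eval_X, smul_eq_mul]
  ring

/-- The real-linear form `h ↦ u h + v h̄`, i.e. `u dz + v dz̄`. -/
def wform (u v : ℂ) : ℂ →L[ℝ] ℂ :=
  u • (ContinuousLinearMap.id ℝ ℂ) + v • (Complex.conjCLE : ℂ →L[ℝ] ℂ)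

theorem wform_apply (u v h : ℂ) : wform u v h = u * h + v * (starRingEnd ℂ) h := by
  simp [wform]

theorem dz_eq_of_hasFDerivAt {F : ℂ → ℂ} {u v z : ℂ} (h : HasFDerivAt F (wform u v) z) :
    dz F z = u := by
  rw [dz, h.fderiv, wform_apply, wform_apply]
  simp only [map_one, Complex.conj_I]
  linear_combination (-(1 / 2 : ℂ) * (u - v)) * Complex.I_mul_I

theorem hasFDerivAt_wform_id (z : ℂ) : HasFDerivAt (fun z : ℂ => z) (wform 1 0) z := by
  refine (hasFDerivAt_id (𝕜 := ℝ) z).congr_fderiv (ContinuousLinearMap.ext fun x => ?_)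
  simp [wform_apply]

theorem HasFDerivAt.wform_conj {F : ℂ → ℂ} {u v z : ℂ} (h : HasFDerivAt F (wform u v) z) :
    HasFDerivAt (fun z => (starRingEnd ℂ) (F z))
      (wform ((starRingEnd ℂ) v) ((starRingEnd ℂ) u)) z := by
  refine HasFDerivAt.congr_fderiv ((Complex.conjCLE : ℂ →L[ℝ] ℂ).hasFDerivAt.comp z h)
    (ContinuousLinearMap.ext fun x => ?_)
  simp [wform_apply]
  ring

theorem HasFDerivAt.wform_add {F G : ℂ → ℂ} {u v u' v' z : ℂ} (h : HasFDerivAt F (wform u v) z)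
    (h' : HasFDerivAt G (wform u' v') z) :
    HasFDerivAt (fun z => F z + G z) (wform (u + u') (v + v')) z := by
  refine HasFDerivAt.congr_fderiv (h.add h') (ContinuousLinearMap.ext fun x => ?_)
  simp [wform_apply]
  ring

theorem HasFDerivAt.wform_mul {F G : ℂ → ℂ} {u v u' v' z : ℂ} (h : HasFDerivAt F (wform u v) z)
    (h' : HasFDerivAt G (wform u' v') z) :
    HasFDerivAt (fun z => F z * G z) (wform (u * G z + F z * u') (v * G z + F z * v')) z := by
  refine HasFDerivAt.congr_fderiv (h.mul h') (ContinuousLinearMap.ext fun x => ?_)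
  simp [wform_apply]
  ring

theorem HasFDerivAt.wform_const_mul {F : ℂ → ℂ} {u v z : ℂ} (c : ℂ)
    (h : HasFDerivAt F (wform u v) z) :
    HasFDerivAt (fun z => c * F z) (wform (c * u) (c * v)) z := by
  refine HasFDerivAt.congr_fderiv (h.const_mul c) (ContinuousLinearMap.ext fun x => ?_)
  simp [wform_apply]
  ring

theorem HasFDerivAt.wform_cexp {F : ℂ → ℂ} {u v z : ℂ} (h : HasFDerivAt F (wform u v) z) :
    HasFDerivAt (fun z => Complex.exp (F z))
      (wform (u * Complex.exp (F z)) (v * Complex.exp (F z))) z := by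
  refine HasFDerivAt.congr_fderiv (h.cexp) (ContinuousLinearMap.ext fun x => ?_)
  simp [wform_apply]
  ring

/-- The polynomial `(z̄ − ∂_z)^n z^m`. -/
def landauPoly : ℕ → ℕ → ℂ → ℂ
  | 0, m, z => z ^ m
  | n + 1, m, z => (starRingEnd ℂ) z * landauPoly n m z - m * landauPoly n (m - 1) z

theorem hasFDerivAt_landauPoly (n m : ℕ) (z : ℂ) :
    HasFDerivAt (landauPoly n m)
      (wform (m * landauPoly n (m - 1) z) (n * landauPoly (n - 1) m z)) z := by
  induction n generalizing m with
  | zero =>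
    have h := ((hasDerivAt_pow m z).hasFDerivAt).restrictScalars ℝ
    refine h.congr_fderiv (ContinuousLinearMap.ext fun x => ?_)
    simp [wform_apply, landauPoly]
    ring
  | succ n ih =>
    have h := (((hasFDerivAt_wform_id z).wform_conj).wform_mul (ih m)).wform_add
      ((ih (m - 1)).wform_const_mul (-(m : ℂ)))
    convert h using 1
    · funext w
      simp only [landauPoly]
      ring
    · congr 1
      · simp only [landauPoly, map_zero]
        ring
      · cases n with
        | zero => simp [landauPoly]
        | succ n =>
          simp only [landauPoly, map_one, Nat.add_sub_cancel]
          push_cast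
          ring

theorem Tbar_iterate_pow (n m : ℕ) : Tbar^[n] (fun w => w ^ m) = landauPoly n m := by
  induction n with
  | zero => rfl
  | succ n ih =>
    rw [Function.iterate_succ_apply', ih]
    funext z
    rw [Tbar, dz_eq_of_hasFDerivAt (hasFDerivAt_landauPoly n m z), landauPoly]

/-- Continuous functions of at most polynomial growth. -/
def PolyGrowth (F : ℂ → ℂ) : Prop :=
  Continuous F ∧ ∃ (C : ℝ) (N : ℕ), 0 ≤ C ∧ ∀ z, ‖F z‖ ≤ C * (1 + ‖z‖) ^ N

namespace PolyGrowth

theorem const (c : ℂ) : PolyGrowth fun _ => c :=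
  ⟨continuous_const, ‖c‖, 0, norm_nonneg _, fun z => by simp⟩

theorem id : PolyGrowth fun z => z :=
  ⟨continuous_id, 1, 1, zero_le_one, fun z => by simp⟩

theorem conj {F : ℂ → ℂ} (h : PolyGrowth F) : PolyGrowth fun z => (starRingEnd ℂ) (F z) := by
  obtain ⟨hc, C, N, h0, hb⟩ := h
  exact ⟨Complex.continuous_conj.comp hc, C, N, h0, fun z => by simpa using hb z⟩

theorem mul {F G : ℂ → ℂ} (h : PolyGrowth F) (h' : PolyGrowth G) :
    PolyGrowth fun z => F z * G z := by
  obtain ⟨hc, C, N, h0, hb⟩ := h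
  obtain ⟨hc', C', N', h0', hb'⟩ := h'
  refine ⟨hc.mul hc', C * C', N + N', mul_nonneg h0 h0', fun z => ?_⟩
  calc ‖F z * G z‖ = ‖F z‖ * ‖G z‖ := norm_mul _ _
    _ ≤ (C * (1 + ‖z‖) ^ N) * (C' * (1 + ‖z‖) ^ N') :=
      mul_le_mul (hb z) (hb' z) (norm_nonneg _) (by positivity)
    _ = C * C' * (1 + ‖z‖) ^ (N + N') := by ring

theorem add {F G : ℂ → ℂ} (h : PolyGrowth F) (h' : PolyGrowth G) :
    PolyGrowth fun z => F z + G z := by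
  obtain ⟨hc, C, N, h0, hb⟩ := h
  obtain ⟨hc', C', N', h0', hb'⟩ := h'
  refine ⟨hc.add hc', C + C', N + N', add_nonneg h0 h0', fun z => ?_⟩
  have h1 : (1 : ℝ) ≤ 1 + ‖z‖ := by linarith [norm_nonneg z]
  have e1 : (1 + ‖z‖) ^ N ≤ (1 + ‖z‖) ^ (N + N') := pow_le_pow_right₀ h1 (by omega)
  have e2 : (1 + ‖z‖) ^ N' ≤ (1 + ‖z‖) ^ (N + N') := pow_le_pow_right₀ h1 (by omega)
  calc ‖F z + G z‖ ≤ ‖F z‖ + ‖G z‖ := norm_add_le _ _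
    _ ≤ C * (1 + ‖z‖) ^ (N + N') + C' * (1 + ‖z‖) ^ (N + N') :=
      add_le_add ((hb z).trans (mul_le_mul_of_nonneg_left e1 h0))
        ((hb' z).trans (mul_le_mul_of_nonneg_left e2 h0'))
    _ = (C + C') * (1 + ‖z‖) ^ (N + N') := by ring

theorem sub {F G : ℂ → ℂ} (h : PolyGrowth F) (h' : PolyGrowth G) :
    PolyGrowth fun z => F z - G z := by
  convert h.add ((const (-1)).mul h') using 2
  ring

theorem landauPoly (n m : ℕ) : PolyGrowth (landauPoly n m) := by
  induction n generalizing m with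
  | zero =>
    induction m with
    | zero => simpa [_root_.landauPoly, funext_iff] using const 1
    | succ m ih =>
      convert ih.mul id using 1
      funext z
      simp [_root_.landauPoly, pow_succ]
  | succ n ih => exact (id.conj.mul (ih m)).sub ((const m).mul (ih (m - 1)))

end PolyGrowth

/-- The plane wave times the Gaussian weight `e^{-|z|²}`. -/
def gaussWave (q z : ℂ) : ℂ :=
  Complex.exp (Complex.I / 2 * ((starRingEnd ℂ) q * z + q * (starRingEnd ℂ) z)
    - (starRingEnd ℂ) z * z)

theorem gaussWave_exponent (q z : ℂ) :
    Complex.I / 2 * ((starRingEnd ℂ) q * z + q * (starRingEnd ℂ) z) - (starRingEnd ℂ) z * z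
      = Complex.I * ((((starRingEnd ℂ) q * z).re : ℝ) : ℂ) - (Complex.normSq z : ℂ) := by
  rw [Complex.re_eq_add_conj, Complex.normSq_eq_conj_mul_self]
  simp only [map_mul, Complex.conj_conj]
  ring

theorem norm_gaussWave (q z : ℂ) : ‖gaussWave q z‖ = Real.exp (-‖z‖ ^ 2) := by
  rw [gaussWave, gaussWave_exponent, Complex.norm_exp]
  simp [Complex.normSq_eq_norm_sq, -Complex.ofReal_pow]

theorem continuous_gaussWave (q : ℂ) : Continuous (gaussWave q) := by
  unfold gaussWave
  have := Complex.continuous_conj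
  fun_prop

theorem hasFDerivAt_gaussWave (q z : ℂ) :
    HasFDerivAt (gaussWave q)
      (wform ((Complex.I / 2 * (starRingEnd ℂ) q - (starRingEnd ℂ) z) * gaussWave q z)
        ((Complex.I / 2 * q - z) * gaussWave q z)) z := by
  have h := hasFDerivAt_wform_id z
  have h' := ((((h.wform_const_mul ((starRingEnd ℂ) q)).wform_add
    (h.wform_conj.wform_const_mul q)).wform_const_mul (Complex.I / 2)).wform_add
    ((h.wform_conj.wform_mul h).wform_const_mul (-1))).wform_cexp
  convert h' using 1
  · funext w
    simp only [gaussWave]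
    ring_nf
  · congr 1 <;>
    · simp only [gaussWave, map_zero, map_one]
      ring_nf

theorem PolyGrowth.integrable {F : ℂ → ℂ} (h : PolyGrowth F) (q : ℂ) :
    Integrable fun z => F z * gaussWave q z := by
  obtain ⟨hc, C, N, h0, hb⟩ := h
  have hr : (Module.finrank ℝ ℂ : ℝ) < 3 := by
    rw [Complex.finrank_real_complex]; norm_num
  refine ((integrable_one_add_norm (μ := volume) hr).const_mul
    (C * ((N + 3).factorial * Real.exp 2))).mono'
    (hc.mul (continuous_gaussWave q)).aestronglyMeasurable (Filter.Eventually.of_forall fun z => ?_)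
  rw [norm_mul, norm_gaussWave]
  have hz := norm_nonneg z
  have h1 := hb z
  generalize ‖z‖ = t at hz h1 ⊢
  have h3 : (1 + t) ^ (N + 3) * Real.exp (-t ^ 2) ≤ (N + 3).factorial * Real.exp 2 := by
    have h4 := Real.pow_div_factorial_le_exp (1 + t) (by linarith) (N + 3)
    rw [div_le_iff₀ (by positivity)] at h4
    calc (1 + t) ^ (N + 3) * Real.exp (-t ^ 2)
        ≤ Real.exp (1 + t) * (N + 3).factorial * Real.exp (-t ^ 2) := by gcongr
      _ = (N + 3).factorial * Real.exp (1 + t - t ^ 2) := by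
        rw [sub_eq_add_neg, Real.exp_add (1 + t)]; ring
      _ ≤ (N + 3).factorial * Real.exp 2 := by
        gcongr
        nlinarith [sq_nonneg (t - 1 / 2)]
  have h5 : (1 + t) ^ (-3 : ℝ) = ((1 + t) ^ 3)⁻¹ := by
    rw [Real.rpow_neg (by linarith)]
    norm_cast
  rw [h5, ← div_eq_mul_inv, le_div_iff₀ (by positivity)]
  calc ‖F z‖ * Real.exp (-t ^ 2) * (1 + t) ^ 3
      ≤ C * (1 + t) ^ N * Real.exp (-t ^ 2) * (1 + t) ^ 3 := by gcongr
    _ = C * ((1 + t) ^ (N + 3) * Real.exp (-t ^ 2)) := by ring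
    _ ≤ _ := by gcongr

theorem integral_fderiv_apply_eq_zero {h : ℂ → ℂ} {h' : ℂ → ℂ →L[ℝ] ℂ} (v : ℂ)
    (hd : ∀ z, HasFDerivAt h (h' z) z) (hi : Integrable h)
    (hi' : Integrable fun z => h' z v) : ∫ z, h' z v = 0 := by
  have e : ∀ z, fderiv ℝ h z = h' z := fun z => (hd z).fderiv
  have := integral_smul_fderiv_eq_neg_fderiv_smul_of_integrable (𝕜 := ℝ) (μ := volume)
    (f := fun _ : ℂ => (1 : ℝ)) (g := h) (v := v) (by simp) (by simpa [e] using hi')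
    (by simpa using hi) (fun _ _ => differentiableAt_const _)
    (fun z _ => (hd z).differentiableAt)
  simpa [e] using this

theorem integral_wirtinger_eq_zero {P u v : ℂ → ℂ} (q : ℂ)
    (hd : ∀ z, HasFDerivAt P (wform (u z) (v z)) z)
    (hP : PolyGrowth P) (hu : PolyGrowth u) (hv : PolyGrowth v) :
    ∫ z, (u z + P z * (Complex.I / 2 * (starRingEnd ℂ) q - (starRingEnd ℂ) z)) * gaussWave q z = 0
    ∧ ∫ z, (v z + P z * (Complex.I / 2 * q - z)) * gaussWave q z = 0 := by
  have i1 := (hu.add (hP.mul ((PolyGrowth.const (Complex.I / 2 * (starRingEnd ℂ) q)).sub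
    PolyGrowth.id.conj))).integrable q
  have i2 := (hv.add (hP.mul ((PolyGrowth.const (Complex.I / 2 * q)).sub
    PolyGrowth.id))).integrable q
  have hh := fun z => (hd z).wform_mul (hasFDerivAt_gaussWave q z)
  set U := fun z => (u z + P z * (Complex.I / 2 * (starRingEnd ℂ) q - (starRingEnd ℂ) z))
    * gaussWave q z with hU
  set V := fun z => (v z + P z * (Complex.I / 2 * q - z)) * gaussWave q z with hV
  have hh' : ∀ z, HasFDerivAt (fun z => P z * gaussWave q z) (wform (U z) (V z)) z := by
    intro z
    convert hh z using 2 <;> simp only [hU, hV] <;> ring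
  have a1 := integral_fderiv_apply_eq_zero 1 hh' (hP.integrable q)
    ((i1.add i2).congr (Filter.Eventually.of_forall fun z => by simp [wform_apply]))
  have a2 := integral_fderiv_apply_eq_zero Complex.I hh' (hP.integrable q)
    (((i1.mul_const Complex.I).sub (i2.mul_const Complex.I)).congr
      (Filter.Eventually.of_forall fun z => by simp [wform_apply, sub_eq_add_neg]))
  simp only [wform_apply, map_one, Complex.conj_I, mul_one, mul_neg, ← sub_eq_add_neg,
    ← sub_mul] at a1 a2
  rw [integral_add i1 i2] at a1
  rw [integral_mul_const, integral_sub i1 i2] at a2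
  have a3 := (mul_eq_zero.mp a2).resolve_right Complex.I_ne_zero
  constructor
  · linear_combination (a1 + a3) / 2
  · linear_combination (a1 - a3) / 2

/-- Matrix elements of the plane wave between unnormalised Landau-level states. -/
def waveMatrix (m m' : ℕ) (q : ℂ) (a b : ℕ) : ℂ :=
  ∫ z, (starRingEnd ℂ) (landauPoly a m' z) * landauPoly b m z * gaussWave q z

theorem integral_conj_landauPoly_mul_eq_zero (m m' : ℕ) (q : ℂ) (a b : ℕ) :
    ∫ z, ((starRingEnd ℂ) (a * landauPoly (a - 1) m' z) * landauPoly b m z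
        + (starRingEnd ℂ) (landauPoly a m' z) * (m * landauPoly b (m - 1) z)
        + (starRingEnd ℂ) (landauPoly a m' z) * landauPoly b m z
          * (Complex.I / 2 * (starRingEnd ℂ) q - (starRingEnd ℂ) z)) * gaussWave q z = 0
    ∧ ∫ z, ((starRingEnd ℂ) (m' * landauPoly a (m' - 1) z) * landauPoly b m z
        + (starRingEnd ℂ) (landauPoly a m' z) * (b * landauPoly (b - 1) m z)
        + (starRingEnd ℂ) (landauPoly a m' z) * landauPoly b m z
          * (Complex.I / 2 * q - z)) * gaussWave q z = 0 :=
  integral_wirtinger_eq_zero q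
    (fun z => (hasFDerivAt_landauPoly a m' z).wform_conj.wform_mul (hasFDerivAt_landauPoly b m z))
    ((PolyGrowth.landauPoly a m').conj.mul (PolyGrowth.landauPoly b m))
    ((((PolyGrowth.const a).mul (PolyGrowth.landauPoly (a - 1) m')).conj.mul
      (PolyGrowth.landauPoly b m)).add ((PolyGrowth.landauPoly a m').conj.mul
        ((PolyGrowth.const m).mul (PolyGrowth.landauPoly b (m - 1)))))
    ((((PolyGrowth.const m').mul (PolyGrowth.landauPoly a (m' - 1))).conj.mul
      (PolyGrowth.landauPoly b m)).add ((PolyGrowth.landauPoly a m').conj.mul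
        ((PolyGrowth.const b).mul (PolyGrowth.landauPoly (b - 1) m))))

theorem integrable_waveMatrix (m m' : ℕ) (q : ℂ) (a b : ℕ) :
    Integrable fun z =>
      (starRingEnd ℂ) (landauPoly a m' z) * landauPoly b m z * gaussWave q z :=
  ((PolyGrowth.landauPoly a m').conj.mul (PolyGrowth.landauPoly b m)).integrable q

theorem waveMatrix_succ_right (m m' : ℕ) (q : ℂ) (a b : ℕ) :
    waveMatrix m m' q a (b + 1)
      = Complex.I / 2 * (starRingEnd ℂ) q * waveMatrix m m' q a b
        + a * waveMatrix m m' q (a - 1) b := by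
  have h := (integral_conj_landauPoly_mul_eq_zero m m' q a b).1
  rw [← sub_eq_zero, ← neg_eq_zero, ← h]
  simp only [waveMatrix]
  rw [← integral_const_mul, ← integral_const_mul, ← integral_add, ← integral_sub, ← integral_neg]
  · refine integral_congr_ae (Filter.Eventually.of_forall fun z => ?_)
    simp only [landauPoly, map_mul, map_natCast]
    ring
  · exact integrable_waveMatrix ..
  · exact ((integrable_waveMatrix ..).const_mul _).add ((integrable_waveMatrix ..).const_mul _)
  · exact (integrable_waveMatrix ..).const_mul _
  · exact (integrable_waveMatrix ..).const_mul _

theorem waveMatrix_succ_left_zero (m m' : ℕ) (q : ℂ) (a : ℕ) :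
    waveMatrix m m' q (a + 1) 0 = Complex.I / 2 * q * waveMatrix m m' q a 0 := by
  have h := (integral_conj_landauPoly_mul_eq_zero m m' q a 0).2
  rw [← sub_eq_zero, ← neg_eq_zero, ← h]
  simp only [waveMatrix]
  rw [← integral_const_mul, ← integral_sub, ← integral_neg]
  · refine integral_congr_ae (Filter.Eventually.of_forall fun z => ?_)
    simp only [landauPoly, map_mul, map_sub, map_natCast, Complex.conj_conj, Nat.cast_zero]
    ring
  · exact integrable_waveMatrix ..
  · exact (integrable_waveMatrix ..).const_mul _

theorem waveMatrix_diag (m m' : ℕ) (q : ℂ) (n : ℕ) :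
    waveMatrix m m' q n n
      = n.factorial * (Lag n (Complex.normSq q / 4) : ℂ) * waveMatrix m m' q 0 0 := by
  rw [contraction_sum (waveMatrix m m' q) _ _ (waveMatrix_succ_left_zero m m' q)
    (waveMatrix_succ_right m m' q), mul_comm]
  congr 1
  rw [← Finset.sum_range_reflect, Lag, Complex.ofReal_sum, Finset.mul_sum]
  refine Finset.sum_congr rfl fun l hl => ?_
  have hl' : l ≤ n := Nat.lt_succ_iff.mp (Finset.mem_range.mp hl)
  have e2 : n - (n - l) = l := by omega
  have e3 : (l.factorial : ℂ) * n.descFactorial (n - l) = n.factorial := by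
    have := Nat.factorial_mul_descFactorial (Nat.sub_le n l)
    rw [e2] at this
    exact_mod_cast this
  have hne : (l.factorial : ℂ) ≠ 0 := by exact_mod_cast l.factorial_ne_zero
  have e4 : (-((Complex.normSq q : ℂ) / 4)) ^ l
      = (Complex.I / 2 * (starRingEnd ℂ) q) ^ l * (Complex.I / 2 * q) ^ l := by
    rw [← mul_pow, Complex.normSq_eq_conj_mul_self]
    congr 1
    linear_combination (-(starRingEnd ℂ) q * q / 4) * Complex.I_mul_I
  simp only [Nat.add_sub_cancel]
  push_cast
  rw [e2, Nat.choose_symm hl', e4, ← e3]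
  field_simp

theorem integral_phi (n m m' : ℕ) (q : ℂ) :
    ∫ z : ℂ, (starRingEnd ℂ) (phi n m' z)
        * Complex.exp (Complex.I * ((((starRingEnd ℂ) q * z).re : ℝ) : ℂ)) * phi n m z
      = (n.factorial : ℂ)⁻¹ * ((Real.sqrt (Real.pi * m'.factorial) : ℂ)⁻¹
          * (Real.sqrt (Real.pi * m.factorial) : ℂ)⁻¹) * waveMatrix m m' q n n := by
  have hs : ∀ k : ℕ, Real.sqrt (Real.pi * n.factorial * k.factorial)
      = Real.sqrt n.factorial * Real.sqrt (Real.pi * k.factorial) := fun k => by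
    rw [← Real.sqrt_mul (by positivity)]
    ring_nf
  have hn : (Real.sqrt n.factorial : ℂ)⁻¹ * (Real.sqrt n.factorial : ℂ)⁻¹
      = (n.factorial : ℂ)⁻¹ := by
    rw [← mul_inv, ← Complex.ofReal_mul, Real.mul_self_sqrt (by positivity),
      Complex.ofReal_natCast]
  rw [waveMatrix, ← integral_const_mul]
  refine integral_congr_ae (Filter.Eventually.of_forall fun z => ?_)
  have hg : gaussWave q z = Complex.exp (-(Complex.normSq z : ℂ) / 2)
      * Complex.exp (Complex.I * ((((starRingEnd ℂ) q * z).re : ℝ) : ℂ))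
      * Complex.exp (-(Complex.normSq z : ℂ) / 2) := by
    rw [gaussWave, gaussWave_exponent, ← Complex.exp_add, ← Complex.exp_add]
    congr 1
    ring
  have hc : (starRingEnd ℂ) (Complex.exp (-(Complex.normSq z : ℂ) / 2))
      = Complex.exp (-(Complex.normSq z : ℂ) / 2) := by
    rw [← Complex.exp_conj, map_div₀, map_neg, Complex.conj_ofReal, map_ofNat]
  simp only [phi, Tbar_iterate_pow, hs, map_mul, map_inv₀, Complex.conj_ofReal, hc, hg,
    Complex.ofReal_mul, mul_inv, ← hn]
  ring

/-- plane waves projected in Landau levels: for the plane wave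
`z ↦ e^{i Re(q̄ z)}` (i.e. `e^{i q·r}` with `B = 2`),
`⟨φ_{n,m′}| e^{iq·r} |φ_{n,m}⟩ = Lₙ(|q|²/4) ⟨φ_{0,m′}| e^{iq·r} |φ_{0,m}⟩`. -/
theorem stmt14 (n m m' : ℕ) (q : ℂ) :
    ∫ z : ℂ, (starRingEnd ℂ) (phi n m' z)
        * Complex.exp (Complex.I * ((((starRingEnd ℂ) q * z).re : ℝ) : ℂ)) * phi n m z
      = (Lag n (Complex.normSq q / 4) : ℂ) *
        ∫ z : ℂ, (starRingEnd ℂ) (phi 0 m' z)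
          * Complex.exp (Complex.I * ((((starRingEnd ℂ) q * z).re : ℝ) : ℂ)) * phi 0 m z := by
  rw [integral_phi, integral_phi, waveMatrix_diag]
  have hne : (n.factorial : ℂ) ≠ 0 := by exact_mod_cast n.factorial_ne_zero
  simp only [Nat.factorial_zero, Nat.cast_one, inv_one]
  field_simp
end
end

section
/- Fourier transform of the Laguerre–Gaussian cyclotron density: for every n ∈ ℕ and every q ∈ ℂ, (1/(π n!)) ∫_ℂ |z|^{2n} e^{−|z|²} e^{i Re(conj(q)·z)} d²z = Lₙ(|q|²/4) · e^{−|q|²/4}, where Lₙ(u) = Σ_{l=0}^{n} C(n,l)(−u)^l/l! is the Laguerre polynomial. (This is the diagonal matrix element ⟨φ_{n,0}| e^{i q·r} |φ_{n,0}⟩, exhibiting the Landau-level form factor Lₙ(|q|²/4) e^{−|q|²/8} of the cyclotron oscillator.) -/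
open MeasureTheory

noncomputable section

/-- The integrand `|z|^{2n} e^{−b|z|²} e^{i Re(q̄ z)}`. -/
def gaussianMomentIntegrand (q : ℂ) (n : ℕ) (b : ℝ) (z : ℂ) : ℂ :=
  (Complex.normSq z : ℂ) ^ n * Complex.exp (-((b : ℂ) * (Complex.normSq z : ℂ)))
    * Complex.exp (Complex.I * ((((starRingEnd ℂ) q * z).re : ℝ) : ℂ))

/-- The coefficient of `u^l` in `n! Lₙ(a u)`. -/
def lagCoeff (a : ℝ) (n l : ℕ) : ℝ :=
  n.factorial * ((n.choose l : ℝ) * (-a) ^ l / l.factorial)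

/-- The closed form `n! b^{−n−1} Lₙ(a/b) e^{−a/b}`. -/
def gaussianMoment (a : ℝ) (n : ℕ) (b : ℝ) : ℝ :=
  (∑ l ∈ Finset.range (n + 1), lagCoeff a n l * b⁻¹ ^ (n + l + 1)) * Real.exp (-a * b⁻¹)

lemma lagCoeff_succ_zero (a : ℝ) (n : ℕ) :
    lagCoeff a (n + 1) 0 = (n + 1) * lagCoeff a n 0 := by
  simp [lagCoeff, Nat.factorial_succ]

lemma lagCoeff_self_succ (a : ℝ) (n : ℕ) : lagCoeff a n (n + 1) = 0 := by
  simp [lagCoeff]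

lemma lagCoeff_succ_succ (a : ℝ) (n l : ℕ) :
    lagCoeff a (n + 1) (l + 1) = (n + l + 2) * lagCoeff a n (l + 1) - a * lagCoeff a n l := by
  have h : (n.choose (l + 1) : ℝ) * (l + 1) = n.choose l * (n - l) := by
    rcases le_or_gt l n with hl | hl
    · have := congrArg (Nat.cast : ℕ → ℝ) (Nat.choose_succ_right_eq n l)
      push_cast [Nat.cast_sub hl] at this
      exact this
    · simp [Nat.choose_eq_zero_of_lt hl, Nat.choose_eq_zero_of_lt (Nat.lt_succ_of_lt hl)]
  have hf : (l.factorial : ℝ) ≠ 0 := by positivity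
  have hl : (l : ℝ) + 1 ≠ 0 := by positivity
  simp only [lagCoeff, Nat.factorial_succ, Nat.choose_succ_succ]
  push_cast
  field_simp
  linear_combination (-a) ^ (l + 1) * (-h)

lemma sum_lagCoeff_succ (a s : ℝ) (n : ℕ) :
    ∑ l ∈ Finset.range (n + 2), lagCoeff a (n + 1) l * s ^ (n + 1 + l + 1) =
      ∑ l ∈ Finset.range (n + 1),
        lagCoeff a n l * ((n + l + 1) * s ^ (n + l + 2) - a * s ^ (n + l + 3)) := by
  have h : ∑ l ∈ Finset.range (n + 1), (n + l + 1) * lagCoeff a n l * s ^ (n + l + 2) =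
      ∑ l ∈ Finset.range (n + 2), (n + l + 1) * lagCoeff a n l * s ^ (n + l + 2) := by
    rw [Finset.sum_range_succ _ (n + 1), lagCoeff_self_succ]
    simp
  have h' : ∑ l ∈ Finset.range (n + 1),
        lagCoeff a n l * ((n + l + 1) * s ^ (n + l + 2) - a * s ^ (n + l + 3)) =
      ∑ l ∈ Finset.range (n + 1), (n + l + 1) * lagCoeff a n l * s ^ (n + l + 2) -
        ∑ l ∈ Finset.range (n + 1), a * lagCoeff a n l * s ^ (n + l + 3) := by
    rw [← Finset.sum_sub_distrib]
    exact Finset.sum_congr rfl fun l _ => by ring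
  rw [h', h, Finset.sum_range_succ', Finset.sum_range_succ' _ (n + 1), add_sub_right_comm,
    ← Finset.sum_sub_distrib, lagCoeff_succ_zero]
  congr 1
  · refine Finset.sum_congr rfl fun l _ => ?_
    rw [lagCoeff_succ_succ]
    push_cast
    ring
  · push_cast
    ring

lemma hasDerivAt_gaussianMoment (a : ℝ) (n : ℕ) {b : ℝ} (hb : b ≠ 0) :
    HasDerivAt (gaussianMoment a n) (-gaussianMoment a (n + 1) b) b := by
  have hinv := hasDerivAt_inv hb
  have hsum := HasDerivAt.fun_sum (u := Finset.range (n + 1)) fun l _ =>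
    ((hinv.fun_pow (n + l + 1)).const_mul (lagCoeff a n l))
  have hexp := (hinv.const_mul (-a)).exp
  refine (hsum.mul hexp).congr_deriv ?_
  have key : ∑ l ∈ Finset.range (n + 1),
        lagCoeff a n l * (((n + l + 1 : ℕ) : ℝ) * b⁻¹ ^ (n + l + 1 - 1) * -(b ^ 2)⁻¹) +
      (∑ l ∈ Finset.range (n + 1), lagCoeff a n l * b⁻¹ ^ (n + l + 1)) * (a * (b ^ 2)⁻¹) =
      -∑ l ∈ Finset.range (n + 1),
        lagCoeff a n l * ((n + l + 1) * b⁻¹ ^ (n + l + 2) - a * b⁻¹ ^ (n + l + 3)) := by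
    rw [Finset.sum_mul, ← Finset.sum_add_distrib, ← Finset.sum_neg_distrib]
    refine Finset.sum_congr rfl fun l _ => ?_
    rw [Nat.add_sub_cancel]
    push_cast
    ring
  rw [gaussianMoment, sum_lagCoeff_succ]
  linear_combination Real.exp (-a * b⁻¹) * key

lemma gaussianMomentIntegrand_zero (q : ℂ) (b : ℝ) (z : ℂ) :
    gaussianMomentIntegrand q 0 b z =
      Complex.exp (-(b : ℂ) * (‖z‖ : ℂ) ^ 2 + Complex.I * (inner ℝ q z : ℝ)) := by
  rw [gaussianMomentIntegrand, Complex.inner, pow_zero, one_mul, ← Complex.exp_add,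
    Complex.normSq_eq_norm_sq, mul_comm z]
  push_cast
  ring_nf

lemma continuous_gaussianMomentIntegrand (q : ℂ) (n : ℕ) (b : ℝ) :
    Continuous (gaussianMomentIntegrand q n b) := by
  have := Complex.continuous_normSq
  unfold gaussianMomentIntegrand
  fun_prop

lemma norm_gaussianMomentIntegrand (q : ℂ) (n : ℕ) (b : ℝ) (z : ℂ) :
    ‖gaussianMomentIntegrand q n b z‖ =
      Complex.normSq z ^ n * Real.exp (-(b * Complex.normSq z)) := by
  have h1 : ‖Complex.exp (Complex.I * ((((starRingEnd ℂ) q * z).re : ℝ) : ℂ))‖ = 1 := by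
    rw [mul_comm, Complex.norm_exp_ofReal_mul_I]
  have h2 : -((b : ℂ) * (Complex.normSq z : ℂ)) = ((-(b * Complex.normSq z) : ℝ) : ℂ) := by
    push_cast
    ring
  rw [gaussianMomentIntegrand, norm_mul, norm_mul, h1, h2, Complex.norm_exp_ofReal, norm_pow,
    Complex.norm_real, Real.norm_of_nonneg (Complex.normSq_nonneg z), mul_one]

lemma integrable_gaussianMomentIntegrand (q : ℂ) (n : ℕ) {b : ℝ} (hb : 0 < b) :
    Integrable (gaussianMomentIntegrand q n b) := by
  have h0 : Integrable (gaussianMomentIntegrand q 0 (b / 2)) := by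
    simp_rw [funext (gaussianMomentIntegrand_zero q (b / 2))]
    exact GaussianFourier.integrable_cexp_neg_mul_sq_norm_add (by simpa using hb) _ _
  refine (h0.norm.const_mul (n.factorial * (2 / b) ^ n)).mono'
    (continuous_gaussianMomentIntegrand q n b).aestronglyMeasurable (.of_forall fun z => ?_)
  rw [norm_gaussianMomentIntegrand, norm_gaussianMomentIntegrand, pow_zero, one_mul]
  set x := Complex.normSq z
  have hx0 : 0 ≤ x := Complex.normSq_nonneg z
  have h := Real.pow_div_factorial_le_exp (x := b / 2 * x) (by positivity) n
  rw [div_le_iff₀ (by positivity)] at h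
  have hsplit : Real.exp (-(b * x)) = Real.exp (-(b / 2 * x)) * Real.exp (-(b / 2 * x)) := by
    rw [← Real.exp_add]
    ring_nf
  have hxn : x ^ n = (2 / b) ^ n * (b / 2 * x) ^ n := by
    rw [← mul_pow]
    congr 1
    field_simp
  calc x ^ n * Real.exp (-(b * x))
      ≤ ((2 / b) ^ n * (Real.exp (b / 2 * x) * n.factorial)) *
          (Real.exp (-(b / 2 * x)) * Real.exp (-(b / 2 * x))) := by
        rw [hsplit, hxn]
        gcongr
    _ = (n.factorial * (2 / b) ^ n) * Real.exp (-(b / 2 * x)) *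
          (Real.exp (b / 2 * x) * Real.exp (-(b / 2 * x))) := by ring
    _ = n.factorial * (2 / b) ^ n * Real.exp (-(b / 2 * x)) := by
        rw [← Real.exp_add, add_neg_cancel, Real.exp_zero, mul_one]

lemma hasDerivAt_gaussianMomentIntegrand (q : ℂ) (n : ℕ) (b : ℝ) (z : ℂ) :
    HasDerivAt (fun b => gaussianMomentIntegrand q n b z)
      (-gaussianMomentIntegrand q (n + 1) b z) b := by
  have h := ((((Complex.ofRealCLM.hasDerivAt (x := b)).mul_const
    (Complex.normSq z : ℂ)).neg.cexp.const_mul ((Complex.normSq z : ℂ) ^ n)).mul_const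
    (Complex.exp (Complex.I * ((((starRingEnd ℂ) q * z).re : ℝ) : ℂ))))
  refine h.congr_deriv ?_
  simp [gaussianMomentIntegrand]
  ring

lemma hasDerivAt_integral_gaussianMomentIntegrand (q : ℂ) (n : ℕ) {b : ℝ} (hb : 0 < b) :
    HasDerivAt (fun b => ∫ z, gaussianMomentIntegrand q n b z)
      (-∫ z, gaussianMomentIntegrand q (n + 1) b z) b := by
  rw [← integral_neg]
  refine (hasDerivAt_integral_of_dominated_loc_of_deriv_le
    (F' := fun b z => -gaussianMomentIntegrand q (n + 1) b z)
    (bound := fun z => ‖gaussianMomentIntegrand q (n + 1) (b / 2) z‖)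
    (Ioi_mem_nhds (half_lt_self hb))
    (.of_forall fun c => (continuous_gaussianMomentIntegrand q n c).aestronglyMeasurable)
    (integrable_gaussianMomentIntegrand q n hb)
    (continuous_gaussianMomentIntegrand q (n + 1) b).neg.aestronglyMeasurable
    (.of_forall fun z c hc => ?_)
    (integrable_gaussianMomentIntegrand q (n + 1) (half_pos hb)).norm
    (.of_forall fun z c _ => hasDerivAt_gaussianMomentIntegrand q n c z)).2
  have hz := Complex.normSq_nonneg z
  have hc' : b / 2 ≤ c := le_of_lt hc
  rw [norm_neg, norm_gaussianMomentIntegrand, norm_gaussianMomentIntegrand]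
  gcongr

lemma integral_gaussianMomentIntegrand (q : ℂ) (n : ℕ) {b : ℝ} (hb : 0 < b) :
    ∫ z, gaussianMomentIntegrand q n b z =
      Real.pi * (gaussianMoment (Complex.normSq q / 4) n b : ℂ) := by
  induction n generalizing b with
  | zero =>
    have hb' : (b : ℂ) ≠ 0 := by exact_mod_cast hb.ne'
    simp_rw [gaussianMomentIntegrand_zero]
    rw [GaussianFourier.integral_cexp_neg_mul_sq_norm_add (by simpa using hb),
      Complex.finrank_real_complex]
    simp [gaussianMoment, lagCoeff, Complex.normSq_eq_norm_sq]
    field_simp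
  | succ n ih =>
    have h1 := hasDerivAt_integral_gaussianMomentIntegrand q n hb
    have h2 := ((hasDerivAt_gaussianMoment (Complex.normSq q / 4) n hb.ne').ofReal_comp).const_mul
      (Real.pi : ℂ)
    have heq := Filter.eventuallyEq_of_mem (Ioi_mem_nhds hb) fun c hc => ih hc
    have := h1.unique (h2.congr_of_eventuallyEq heq)
    push_cast at this
    linear_combination -this

lemma gaussianMoment_one (a : ℝ) (n : ℕ) :
    gaussianMoment a n 1 = n.factorial * (Lag n a * Real.exp (-a)) := by
  simp [gaussianMoment, lagCoeff, Lag, ← Finset.mul_sum, mul_assoc]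

/-- Fourier transform of the Laguerre–Gaussian cyclotron density:
`(1/(π n!)) ∫ |z|^{2n} e^{−|z|²} e^{i Re(q̄ z)} d²z = Lₙ(|q|²/4) e^{−|q|²/4}`,
the diagonal matrix element `⟨φ_{n,0}| e^{iq·r} |φ_{n,0}⟩` exhibiting the Landau-level
form factor of the cyclotron oscillator. -/
theorem stmt15 (n : ℕ) (q : ℂ) :
    ((Real.pi : ℂ) * (n.factorial : ℂ))⁻¹ *
        ∫ z : ℂ, (Complex.normSq z : ℂ) ^ n * Complex.exp (-(Complex.normSq z : ℂ))
          * Complex.exp (Complex.I * ((((starRingEnd ℂ) q * z).re : ℝ) : ℂ))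
      = (Lag n (Complex.normSq q / 4) : ℂ)
        * Complex.exp (-(Complex.normSq q : ℂ) / 4) := by
  have h := integral_gaussianMomentIntegrand q n one_pos
  simp only [gaussianMomentIntegrand, Complex.ofReal_one, one_mul, gaussianMoment_one] at h
  have hpi : (Real.pi : ℂ) ≠ 0 := by exact_mod_cast Real.pi_ne_zero
  have hn : (n.factorial : ℂ) ≠ 0 := by exact_mod_cast n.factorial_ne_zero
  rw [h]
  push_cast
  rw [neg_div]
  field_simp
end
end
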